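/- arXiv:0806.4048 — 2 statements merged into one kernel-verified Lean document; each statement's English description precedes it below -/
import Mathlib

section
/- Let 𝔽 be ℝ or ℂ, let n be a positive integer, and let T = (A_1; A_2; A_3) be an n×n×3 tensor over 𝔽. If the linear span of A_1, A_2, A_3 in the space of n×n matrices over 𝔽 contains a nonzero singular matrix (a nonzero matrix with determinant 0), then rank_𝔽(T) ≤ 2n − 1. -/
/-- The rank of a 3-tensor, presented as a family of matrices (its slices):
the least `r` such that each slice `A k` is `∑ i, (c i k) • (a i) (b i)ᵀ`
for some vectors `a i`, `b i`, `c i`. -/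
noncomputable def tensorRank (𝔽 : Type*) [Field 𝔽] {α β γ : Type*}
    [Fintype α] [Fintype β] [Fintype γ] (A : γ → Matrix α β 𝔽) : ℕ :=
  sInf {r : ℕ | ∃ (a : Fin r → α → 𝔽) (b : Fin r → β → 𝔽) (c : Fin r → γ → 𝔽),
    ∀ k, A k = ∑ i, c i k • Matrix.vecMulVec (a i) (b i)}

/-- `maxRank 𝔽 m n p` is the maximal rank of an `m × n × p` tensor over `𝔽`. -/
noncomputable def maxRank (𝔽 : Type*) [Field 𝔽] (m n p : ℕ) : ℕ :=
  sSup {r : ℕ | ∃ A : Fin p → Matrix (Fin m) (Fin n) 𝔽, tensorRank 𝔽 A = r}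

open Matrix Polynomial Filter Topology

/-- All matrices in `S` lie in the span of `r` common matrices of rank at most one. -/
def CoveredByRankOnes {𝔽 : Type*} [Field 𝔽] {α β : Type*} (r : ℕ) (S : Set (Matrix α β 𝔽)) :
    Prop :=
  ∃ (a : Fin r → α → 𝔽) (b : Fin r → β → 𝔽),
    S ⊆ Submodule.span 𝔽 (Set.range fun i => vecMulVec (a i) (b i))

namespace CoveredByRankOnes

section Field

variable {𝔽 : Type*} [Field 𝔽] {α β γ δ ι : Type*}

theorem of_fintype [Fintype ι] (a : ι → α → 𝔽) (b : ι → β → 𝔽) {S : Set (Matrix α β 𝔽)}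
    (h : S ⊆ Submodule.span 𝔽 (Set.range fun i => vecMulVec (a i) (b i))) :
    CoveredByRankOnes (Fintype.card ι) S := by
  refine ⟨a ∘ (Fintype.equivFin ι).symm, b ∘ (Fintype.equivFin ι).symm, ?_⟩
  have : (Set.range fun i => vecMulVec ((a ∘ (Fintype.equivFin ι).symm) i)
      ((b ∘ (Fintype.equivFin ι).symm) i)) = Set.range fun i => vecMulVec (a i) (b i) :=
    (Fintype.equivFin ι).symm.surjective.range_comp (fun i => vecMulVec (a i) (b i))
  rwa [this]

theorem of_subset_span {r : ℕ} {S S' : Set (Matrix α β 𝔽)} (h : CoveredByRankOnes r S)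
    (hS : S' ⊆ Submodule.span 𝔽 S) : CoveredByRankOnes r S' := by
  obtain ⟨a, b, hab⟩ := h
  exact ⟨a, b, hS.trans (Submodule.span_le.2 hab)⟩

theorem union {r s : ℕ} {S S' : Set (Matrix α β 𝔽)} (h : CoveredByRankOnes r S)
    (h' : CoveredByRankOnes s S') : CoveredByRankOnes (r + s) (S ∪ S') := by
  obtain ⟨a, b, hab⟩ := h
  obtain ⟨a', b', hab'⟩ := h'
  have := of_fintype (ι := Fin r ⊕ Fin s) (S := S ∪ S') (Sum.elim a a') (Sum.elim b b') ?_
  · simpa using this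
  · rintro M (hM | hM)
    · refine Submodule.span_mono ?_ (hab hM)
      rintro _ ⟨i, rfl⟩
      exact ⟨Sum.inl i, rfl⟩
    · refine Submodule.span_mono ?_ (hab' hM)
      rintro _ ⟨i, rfl⟩
      exact ⟨Sum.inr i, rfl⟩

theorem vecMulVec (a : α → 𝔽) (b : β → 𝔽) :
    CoveredByRankOnes 1 {Matrix.vecMulVec a b} :=
  ⟨fun _ => a, fun _ => b, by
    rintro _ rfl
    exact Submodule.subset_span ⟨0, rfl⟩⟩

theorem image_mul_mul [Fintype α] [Fintype β] {r : ℕ} {S : Set (Matrix α β 𝔽)}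
    (h : CoveredByRankOnes r S) (P : Matrix γ α 𝔽) (Q : Matrix β δ 𝔽) :
    CoveredByRankOnes r ((fun M => P * M * Q) '' S) := by
  obtain ⟨a, b, hab⟩ := h
  refine ⟨fun i => P *ᵥ a i, fun i => b i ᵥ* Q, ?_⟩
  rintro _ ⟨M, hM, rfl⟩
  obtain ⟨c, rfl⟩ := (Submodule.mem_span_range_iff_exists_fun 𝔽).1 (hab hM)
  refine (Submodule.mem_span_range_iff_exists_fun 𝔽).2 ⟨c, ?_⟩
  simp [Matrix.mul_sum, Matrix.sum_mul, mul_vecMulVec, vecMulVec_mul]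

theorem triple_mul_mul [Fintype α] [Fintype β] {r : ℕ} {A B C : Matrix α β 𝔽}
    (h : CoveredByRankOnes r {A, B, C}) (P : Matrix γ α 𝔽) (Q : Matrix β δ 𝔽) :
    CoveredByRankOnes r {P * A * Q, P * B * Q, P * C * Q} := by
  simpa [Set.image_insert_eq] using h.image_mul_mul P Q

theorem transpose {r : ℕ} {A B C : Matrix α β 𝔽}
    (h : CoveredByRankOnes r {A, B, C}) : CoveredByRankOnes r {Aᵀ, Bᵀ, Cᵀ} := by
  obtain ⟨a, b, hab⟩ := h
  refine ⟨b, a, ?_⟩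
  have key : ∀ M : Matrix α β 𝔽,
      M ∈ Submodule.span 𝔽 (Set.range fun i => Matrix.vecMulVec (a i) (b i)) →
      Mᵀ ∈ Submodule.span 𝔽 (Set.range fun i => Matrix.vecMulVec (b i) (a i)) := by
    intro M hM
    obtain ⟨c, rfl⟩ := (Submodule.mem_span_range_iff_exists_fun 𝔽).1 hM
    refine (Submodule.mem_span_range_iff_exists_fun 𝔽).2 ⟨c, ?_⟩
    simp [transpose_sum, transpose_vecMulVec]
  rintro _ (rfl | rfl | rfl)
  all_goals exact key _ (hab (by simp))

theorem triple_of_mem_span {r : ℕ} {A B C A' B' C' : Matrix α β 𝔽}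
    (h : CoveredByRankOnes r {A, B, C}) (hA : A' ∈ Submodule.span 𝔽 {A, B, C})
    (hB : B' ∈ Submodule.span 𝔽 {A, B, C}) (hC : C' ∈ Submodule.span 𝔽 {A, B, C}) :
    CoveredByRankOnes r {A', B', C'} :=
  h.of_subset_span (by rintro _ (rfl | rfl | rfl) <;> assumption)

theorem mul_diagonal_mul_mem_span [Fintype ι] [DecidableEq ι] (K : Matrix α ι 𝔽)
    (L : Matrix ι β 𝔽) (d : ι → 𝔽) :
    K * diagonal d * L ∈
      Submodule.span 𝔽 (Set.range fun i => Matrix.vecMulVec (fun x => K x i) (L i)) := by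
  refine (Submodule.mem_span_range_iff_exists_fun 𝔽).2 ⟨d, ?_⟩
  ext x y
  rw [Matrix.mul_apply]
  simp only [Matrix.sum_apply, Matrix.smul_apply, vecMulVec_apply, mul_diagonal, smul_eq_mul]
  exact Finset.sum_congr rfl fun i _ => by ring

/-- Diagonal matrices vanishing at a common position. -/
theorem diagonal_of_apply_eq_zero [Fintype ι] [DecidableEq ι] (i₀ : ι) :
    CoveredByRankOnes (Fintype.card ι - 1)
      {M : Matrix ι ι 𝔽 | ∃ d : ι → 𝔽, d i₀ = 0 ∧ M = diagonal d} := by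
  have := of_fintype (ι := {i // i ≠ i₀})
    (S := {M : Matrix ι ι 𝔽 | ∃ d : ι → 𝔽, d i₀ = 0 ∧ M = diagonal d})
    (fun i => Pi.single i.1 (1 : 𝔽)) (fun i => Pi.single i.1 (1 : 𝔽)) ?_
  · simpa using this
  · rintro _ ⟨d, hd, rfl⟩
    refine (Submodule.mem_span_range_iff_exists_fun 𝔽).2 ⟨fun i => d i.1, ?_⟩
    have h1 : ∑ i, d i • Matrix.vecMulVec (Pi.single i (1 : 𝔽)) (Pi.single i (1 : 𝔽))
        = diagonal d := by
      ext x y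
      simp [Matrix.sum_apply, vecMulVec_apply, diagonal_apply, Pi.single_apply]
      split_ifs with hxy <;> simp [hxy]
    rw [← h1, Fintype.sum_eq_add_sum_subtype_ne _ i₀, hd]
    simp

/-- A regular pencil with distinct eigenvalues in the field is covered by as many matrices of
rank at most one as its size. -/
theorem pair_of_injective_of_det_eq_zero [Fintype ι] [DecidableEq ι] {M N : Matrix ι ι 𝔽}
    (hM : M.det ≠ 0) {d : ι → 𝔽} (hd : Function.Injective d)
    (h : ∀ i, (d i • M - N).det = 0) : CoveredByRankOnes (Fintype.card ι) {M, N} := by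
  have hu : IsUnit M.det := isUnit_iff_ne_zero.2 hM
  choose v hv0 hv using fun i => exists_mulVec_eq_zero_iff.2 (h i)
  have hv' : ∀ i, N *ᵥ v i = d i • (M *ᵥ v i) := fun i => by
    have := hv i
    rw [sub_mulVec, smul_mulVec, sub_eq_zero] at this
    exact this.symm
  have hli : LinearIndependent 𝔽 v := by
    refine Module.End.eigenvectors_linearIndependent' (toLin' (M⁻¹ * N)) d hd v fun i => ?_
    refine Module.End.hasEigenvector_iff.2 ⟨Module.End.mem_eigenspace_iff.2 ?_, hv0 i⟩
    rw [toLin'_apply, ← mulVec_mulVec, hv', mulVec_smul, mulVec_mulVec, nonsing_inv_mul _ hu,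
      one_mulVec]
  set P : Matrix ι ι 𝔽 := (of v)ᵀ with hP
  have hPu : IsUnit P.det := by
    rw [← isUnit_iff_isUnit_det]
    exact linearIndependent_cols_iff_isUnit.1 hli
  have hNP : N * P = M * P * diagonal d := by
    ext x i
    have := congrFun (hv' i) x
    rw [mul_diagonal, mul_comm]
    simpa [Matrix.mul_apply, mulVec, dotProduct, hP] using this
  have hM1 : M = M * P * diagonal (fun _ => 1) * P⁻¹ := by
    rw [diagonal_one, Matrix.mul_one, mul_nonsing_inv_cancel_right _ _ hPu]
  have hN1 : N = M * P * diagonal d * P⁻¹ := by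
    rw [← hNP, mul_nonsing_inv_cancel_right _ _ hPu]
  refine of_fintype (fun i x => (M * P) x i) (fun i => P⁻¹ i) ?_
  have hM2 := mul_diagonal_mul_mem_span (M * P) P⁻¹ (fun _ => 1)
  have hN2 := mul_diagonal_mul_mem_span (M * P) P⁻¹ d
  rw [← hM1] at hM2
  rw [← hN1] at hN2
  exact Set.insert_subset hM2 (Set.singleton_subset_iff.2 hN2)

end Field

end CoveredByRankOnes

/-- A simple root of `f (0, ·)` persists for `f (t, ·)` with `t` small. -/
theorem eventually_exists_root_of_hasDerivAt {𝔽 : Type*} [RCLike 𝔽] {f : 𝔽 × 𝔽 → 𝔽}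
    (hf : ContDiff 𝔽 1 f) {z₀ f' : 𝔽} (h₀ : f (0, z₀) = 0)
    (hd : HasDerivAt (fun z => f (0, z)) f' z₀) (hf' : f' ≠ 0) {U : Set 𝔽} (hU : U ∈ 𝓝 z₀) :
    ∀ᶠ t in 𝓝 (0 : 𝔽), ∃ z ∈ U, f (t, z) = 0 := by
  set L := fderiv 𝔽 f (0, z₀)
  have hL : HasStrictFDerivAt f L (0, z₀) := hf.contDiffAt.hasStrictFDerivAt one_ne_zero
  have hL1 : L (0, 1) = f' := by
    have h1 : HasDerivAt (fun z : 𝔽 => ((0 : 𝔽), z)) (0, 1) z₀ :=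
      (hasDerivAt_const z₀ (0 : 𝔽)).prodMk (hasDerivAt_id z₀)
    exact (hL.hasFDerivAt.comp_hasDerivAt z₀ h1).unique hd
  have hG : HasStrictFDerivAt (fun q : 𝔽 × 𝔽 => (q.1, f q))
      ((ContinuousLinearMap.fst 𝔽 𝔽 𝔽).prod L) (0, z₀) :=
    hasStrictFDerivAt_fst.prodMk hL
  have hmap := hG.map_nhds_eq_of_surj (by
    refine LinearMap.range_eq_top.2 ?_
    rintro ⟨x, y⟩
    refine ⟨(x, (y - L (x, 0)) / f'), ?_⟩
    have h2 : ((x, (y - L (x, 0)) / f') : 𝔽 × 𝔽) = (x, 0) + ((y - L (x, 0)) / f') • (0, 1) := by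
      simp
    have h3 : L (x, (y - L (x, 0)) / f') = y := by
      rw [h2, map_add, map_smul, hL1, smul_eq_mul, div_mul_cancel₀ _ hf']
      ring
    simp [h3])
  simp only [h₀] at hmap
  have hV : (fun q : 𝔽 × 𝔽 => (q.1, f q)) '' (Set.univ ×ˢ U) ∈ 𝓝 ((0 : 𝔽), (0 : 𝔽)) := by
    rw [← hmap]
    exact image_mem_map (prod_mem_nhds univ_mem hU)
  have hc : Tendsto (fun t : 𝔽 => (t, (0 : 𝔽))) (𝓝 0) (𝓝 (0, 0)) :=
    (Continuous.tendsto (by fun_prop) _)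
  filter_upwards [hc hV] with t ht
  obtain ⟨⟨t', z⟩, ⟨-, hz⟩, he⟩ := ht
  simp only [Prod.mk.injEq] at he
  exact ⟨z, hz, he.1 ▸ he.2⟩

/-- Distinct roots of the pencil `det (z M - N)` are simple. -/
theorem exists_hasDerivAt_det_smul_sub {𝔽 : Type*} [RCLike 𝔽] {ι : Type*} [Fintype ι]
    [DecidableEq ι] {M N : Matrix ι ι 𝔽} (hM : M.det ≠ 0) {d : ι → 𝔽}
    (hd : Function.Injective d) (h : ∀ i, (d i • M - N).det = 0) (i : ι) :
    ∃ f' ≠ 0, HasDerivAt (fun z => (z • M - N).det) f' (d i) := by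
  have hu : IsUnit M.det := isUnit_iff_ne_zero.2 hM
  set p := (M⁻¹ * N).charpoly with hp
  have hfac : ∀ z, (z • M - N).det = M.det * p.eval z := fun z => by
    rw [hp, eval_charpoly, ← det_mul, Matrix.mul_sub, mul_nonsing_inv_cancel_left _ _ hu]
    congr 2
    rw [scalar_apply, ← smul_one_eq_diagonal, Matrix.mul_smul, Matrix.mul_one]
  have hpe : p = ∏ j, (X - C (d j)) := by
    refine eq_of_monic_of_dvd_of_natDegree_le (monic_prod_of_monic _ _ fun j _ => monic_X_sub_C _)
      (charpoly_monic _) ?_ ?_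
    · refine Finset.prod_dvd_of_coprime
        ((pairwise_coprime_X_sub_C hd).set_pairwise _) fun j _ => ?_
      rw [dvd_iff_isRoot, IsRoot.def]
      have := hfac (d j)
      rw [h j] at this
      exact (mul_eq_zero.1 this.symm).resolve_left hM
    · rw [natDegree_finsetProd_X_sub_C_eq_card]
      rw [charpoly_natDegree_eq_dim]
      rfl
  have hsep : p.Separable := by
    rw [hpe]
    exact separable_prod_X_sub_C_iff.2 hd
  have hroot : p.eval (d i) = 0 := by
    rw [hpe, eval_prod]
    exact Finset.prod_eq_zero (Finset.mem_univ i) (by simp)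
  refine ⟨M.det * (derivative p).eval (d i), mul_ne_zero hM ?_, ?_⟩
  · exact hsep.eval₂_derivative_ne_zero (RingHom.id 𝔽) hroot
  · simp only [hfac]
    exact (p.hasDerivAt (d i)).const_mul _

/-- If `M t`, `N t` are smooth in `t` and the pencil at `t = 0` is regular with distinct
eigenvalues, then so is the pencil at all small `t`. -/
theorem eventually_coveredByRankOnes_pair {𝔽 : Type*} [RCLike 𝔽] {ι : Type*} [Fintype ι]
    [DecidableEq ι] {M N : 𝔽 → Matrix ι ι 𝔽} (hM : ∀ i j, ContDiff 𝔽 1 fun t => M t i j)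
    (hN : ∀ i j, ContDiff 𝔽 1 fun t => N t i j) (hdet : (M 0).det ≠ 0) {d : ι → 𝔽}
    (hd : Function.Injective d) (h : ∀ i, (d i • M 0 - N 0).det = 0) :
    ∀ᶠ t in 𝓝 (0 : 𝔽), CoveredByRankOnes (Fintype.card ι) {M t, N t} := by
  obtain ⟨U, hU, hdisj⟩ := (Set.finite_range d).t2_separation
  have hf : ContDiff 𝔽 1 fun q : 𝔽 × 𝔽 => (q.2 • M q.1 - N q.1).det := by
    simp only [det_apply', Matrix.sub_apply, Matrix.smul_apply, smul_eq_mul]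
    have h1 : ∀ i j, ContDiff 𝔽 1 fun q : 𝔽 × 𝔽 => M q.1 i j := fun i j =>
      (hM i j).comp contDiff_fst
    have h2 : ∀ i j, ContDiff 𝔽 1 fun q : 𝔽 × 𝔽 => N q.1 i j := fun i j =>
      (hN i j).comp contDiff_fst
    fun_prop
  have hroots : ∀ᶠ t in 𝓝 (0 : 𝔽), ∀ i, ∃ z ∈ U (d i), (z • M t - N t).det = 0 := by
    refine eventually_all.2 fun i => ?_
    obtain ⟨f', hf', hder⟩ := exists_hasDerivAt_det_smul_sub hdet hd h i
    exact eventually_exists_root_of_hasDerivAt hf (h i) hder hf'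
      ((hU (d i)).2.mem_nhds (hU (d i)).1)
  have hdet' : ∀ᶠ t in 𝓝 (0 : 𝔽), (M t).det ≠ 0 := by
    have : Continuous fun t => (M t).det :=
      Continuous.matrix_det (continuous_matrix fun i j => (hM i j).continuous)
    exact this.continuousAt.eventually_ne hdet
  filter_upwards [hroots, hdet'] with t ht ht'
  choose z hz hz0 using ht
  refine CoveredByRankOnes.pair_of_injective_of_det_eq_zero ht' (d := z) ?_ hz0
  intro i j hij
  by_contra hne
  exact Set.disjoint_left.1 (hdisj ⟨i, rfl⟩ ⟨j, rfl⟩ (hd.ne hne)) (hz i) (hij ▸ hz j)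

namespace CoveredByRankOnes

section Equivalence

variable {𝔽 : Type*} [Field 𝔽] {ι : Type*} [Fintype ι] [DecidableEq ι]

/-- Multiplying the slices by invertible matrices does not change coverability. -/
theorem of_mul_mul {r : ℕ} {A B C P P' Q Q' : Matrix ι ι 𝔽} (hP : P' * P = 1) (hQ : Q * Q' = 1)
    (h : CoveredByRankOnes r {P * A * Q, P * B * Q, P * C * Q}) :
    CoveredByRankOnes r {A, B, C} := by
  have key : ∀ M : Matrix ι ι 𝔽, P' * (P * M * Q) * Q' = M := fun M => by
    rw [Matrix.mul_assoc, Matrix.mul_assoc (P * M), hQ, Matrix.mul_one, ← Matrix.mul_assoc, hP,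
      Matrix.one_mul]
  simpa only [key] using h.triple_mul_mul P' Q'

theorem submatrix_id {r : ℕ} {A B C : Matrix ι ι 𝔽} (h : CoveredByRankOnes r {A, B, C})
    (σ : ι → ι) :
    CoveredByRankOnes r {A.submatrix id σ, B.submatrix id σ, C.submatrix id σ} := by
  have := h.triple_mul_mul (1 : Matrix ι ι 𝔽) ((1 : Matrix ι ι 𝔽).submatrix (Equiv.refl ι) σ)
  have key : ∀ M : Matrix ι ι 𝔽,
      1 * M * (1 : Matrix ι ι 𝔽).submatrix (Equiv.refl ι) σ = M.submatrix id σ := fun M => by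
    rw [Matrix.one_mul, mul_submatrix_one]
    rfl
  rwa [key, key, key] at this

end Equivalence

section RCLike

variable {𝔽 : Type*} [RCLike 𝔽] {ι : Type*} [Fintype ι] [DecidableEq ι]

/-- Replace the rows of `A` selected by `p` by those of the identity, and those of `B` by those
of `diagonal d`. If the resulting pencil is regular with eigenvalues `d i`, then large diagonal
modifications of `A` and `B` give a pencil covered by `card ι` matrices of rank one. -/
theorem of_rows_replaced {A B : Matrix ι ι 𝔽} {D : ι → 𝔽} {i₀ : ι} (hD : D i₀ = 0)
    (p : ι → Prop) [DecidablePred p] (hp : ¬ p i₀) {d : ι → 𝔽} (hd : Function.Injective d)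
    (hdet : (of fun i j => if p i then (1 : Matrix ι ι 𝔽) i j else A i j).det ≠ 0)
    (hroot : ∀ k, (d k • (of fun i j => if p i then (1 : Matrix ι ι 𝔽) i j else A i j) -
      of fun i j => if p i then diagonal d i j else B i j).det = 0) :
    CoveredByRankOnes (2 * Fintype.card ι - 1) {A, B, diagonal D} := by
  set M : 𝔽 → Matrix ι ι 𝔽 := fun t =>
    of fun i j => if p i then t * A i j + (1 : Matrix ι ι 𝔽) i j else A i j with hM
  set N : 𝔽 → Matrix ι ι 𝔽 := fun t =>
    of fun i j => if p i then t * B i j + diagonal d i j else B i j with hN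
  have hev := eventually_coveredByRankOnes_pair (M := M) (N := N) (d := d)
    (fun i j => by by_cases h : p i <;> simp only [hM, of_apply, h, if_true, if_false] <;> fun_prop)
    (fun i j => by by_cases h : p i <;> simp only [hN, of_apply, h, if_true, if_false] <;> fun_prop)
    (by simpa only [hM, zero_mul, zero_add] using hdet) hd
    (by simpa only [hM, hN, zero_mul, zero_add] using hroot)
  obtain ⟨t, ht, ht0⟩ :=
    ((hev.filter_mono nhdsWithin_le_nhds).and (self_mem_nhdsWithin (s := {(0 : 𝔽)}ᶜ))).exists
  replace ht0 : t ≠ 0 := ht0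
  have h1 := (ht.image_mul_mul (diagonal fun i => if p i then t⁻¹ else 1) 1).union
    (diagonal_of_apply_eq_zero (𝔽 := 𝔽) i₀)
  have hcard : 0 < Fintype.card ι := Fintype.card_pos_iff.2 ⟨i₀⟩
  rw [show Fintype.card ι + (Fintype.card ι - 1) = 2 * Fintype.card ι - 1 by omega] at h1
  have key : ∀ (F : Matrix ι ι 𝔽) (e : ι → 𝔽),
      F = diagonal (fun i => if p i then t⁻¹ else 1) *
        (of fun i j => if p i then t * F i j + diagonal e i j else F i j) * 1 -
        diagonal (fun i => if p i then t⁻¹ * e i else 0) := fun F e => by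
    ext i j
    rw [Matrix.mul_one, Matrix.sub_apply, diagonal_mul, of_apply]
    by_cases h : p i
    · by_cases hij : i = j
      · subst hij
        simp only [h, if_true, diagonal_apply_eq]
        field_simp
        ring
      · simp only [h, if_true, diagonal_apply_ne _ hij]
        field_simp
        ring
    · by_cases hij : i = j
      · subst hij
        simp [h]
      · simp [h, diagonal_apply_ne _ hij]
  refine h1.of_subset_span ?_
  refine Set.insert_subset ?_ (Set.insert_subset ?_ (Set.singleton_subset_iff.2 ?_))
  · rw [SetLike.mem_coe]
    have hk := key A 1
    rw [Pi.one_def, diagonal_one] at hk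
    nth_rewrite 1 [hk]
    refine Submodule.sub_mem _ (Submodule.subset_span (Or.inl ⟨M t, by simp, rfl⟩))
      (Submodule.subset_span (Or.inr ⟨_, by simp [hp], rfl⟩))
  · rw [SetLike.mem_coe]
    have hk := key B d
    nth_rewrite 1 [hk]
    refine Submodule.sub_mem _ (Submodule.subset_span (Or.inl ⟨N t, by simp, rfl⟩))
      (Submodule.subset_span (Or.inr ⟨_, by simp [hp], rfl⟩))
  · exact Submodule.subset_span (Or.inr ⟨D, hD, rfl⟩)

theorem of_apply_self_ne_zero {A B : Matrix ι ι 𝔽} {D : ι → 𝔽} {i₀ : ι} (hD : D i₀ = 0)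
    (hA : A i₀ i₀ ≠ 0) :
    CoveredByRankOnes (2 * Fintype.card ι - 1) {A, B, diagonal D} := by
  obtain ⟨e, he⟩ : ∃ e : ι → 𝔽, Function.Injective e :=
    ⟨fun i => ((Fintype.equivFin ι i : ℕ) : 𝔽), Nat.cast_injective.comp
      (Fin.val_injective.comp (Fintype.equivFin ι).injective)⟩
  set d : ι → 𝔽 := fun i => e i + (B i₀ i₀ / A i₀ i₀ - e i₀) with hd
  have hd₀ : d i₀ * A i₀ i₀ = B i₀ i₀ := by
    simp only [hd]
    field_simp
    ring
  refine of_rows_replaced hD (· ≠ i₀) (by simp) (d := d)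
    (fun i j hij => he (add_right_cancel hij)) ?_ fun k => ?_
  · intro h
    obtain ⟨v, hv0, hv⟩ := exists_mulVec_eq_zero_iff.2 h
    have hv1 : ∀ i, i ≠ i₀ → v i = 0 := fun i hi => by
      simpa [mulVec, dotProduct, hi, one_apply] using congrFun hv i
    have hv2 : v i₀ = 0 := by
      have := congrFun hv i₀
      simp only [mulVec, dotProduct, of_apply, ne_eq, not_true_eq_false, if_false,
        Pi.zero_apply] at this
      rw [Fintype.sum_eq_single i₀ fun i hi => by rw [hv1 i hi, mul_zero]] at this
      exact (mul_eq_zero.1 this).resolve_left hA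
    exact hv0 (funext fun i => if hi : i = i₀ then hi ▸ hv2 else hv1 i hi)
  · by_cases hk : k = i₀
    · subst hk
      refine det_eq_zero_of_column_eq_zero k fun i => ?_
      by_cases hi : i = k
      · subst hi
        simp [hd₀]
      · simp [hi]
    · refine det_eq_zero_of_row_eq_zero k fun j => ?_
      by_cases hj : k = j
      · subst hj
        simp [hk]
      · simp [hk, hj]

theorem of_apply_ne_zero {A B : Matrix ι ι 𝔽} {D : ι → 𝔽} {i₀ j₀ : ι} (hi : D i₀ = 0)
    (hj : D j₀ = 0) (hA : A i₀ j₀ ≠ 0) :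
    CoveredByRankOnes (2 * Fintype.card ι - 1) {A, B, diagonal D} := by
  have hC : (diagonal D).submatrix id (Equiv.swap i₀ j₀) = diagonal D := by
    ext x y
    simp only [submatrix_apply, id_eq, diagonal_apply]
    by_cases hx : D x = 0
    · simp [hx]
    · have hxi : x ≠ i₀ := fun h => hx (h ▸ hi)
      have hxj : x ≠ j₀ := fun h => hx (h ▸ hj)
      have : x = Equiv.swap i₀ j₀ y ↔ x = y := by
        rw [← Equiv.symm_apply_eq, Equiv.symm_swap, Equiv.swap_apply_of_ne_of_ne hxi hxj]
      simp [this]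
  have h := (of_apply_self_ne_zero (A := A.submatrix id (Equiv.swap i₀ j₀))
    (B := B.submatrix id (Equiv.swap i₀ j₀)) hi (by simpa using hA)).submatrix_id
    (Equiv.swap i₀ j₀)
  rw [hC] at h
  have hs : ⇑(Equiv.swap i₀ j₀) ∘ ⇑(Equiv.swap i₀ j₀) = id := by
    ext x
    simp
  simpa only [submatrix_submatrix, Function.comp_id, hs, submatrix_id_id] using h

theorem of_cross_ne_zero_of_ne_zero {A B : Matrix ι ι 𝔽} {D : ι → 𝔽} {i₀ i₁ : ι}
    (hD : D i₀ = 0) (hA₀ : A i₀ i₀ = 0) (hB₀ : B i₀ i₀ = 0) (hA₁ : A i₁ i₀ ≠ 0)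
    (hA₂ : A i₀ i₁ ≠ 0) (hc : A i₁ i₀ * B i₀ i₁ - B i₁ i₀ * A i₀ i₁ ≠ 0) :
    CoveredByRankOnes (2 * Fintype.card ι - 1) {A, B, diagonal D} := by
  obtain ⟨e, he⟩ : ∃ e : ι → 𝔽, Function.Injective e :=
    ⟨fun i => ((Fintype.equivFin ι i : ℕ) : 𝔽), Nat.cast_injective.comp
      (Fin.val_injective.comp (Fintype.equivFin ι).injective)⟩
  have hne : i₁ ≠ i₀ := by
    rintro rfl
    exact hA₁ hA₀
  have he' : e i₁ - e i₀ ≠ 0 := sub_ne_zero.2 (he.ne hne)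
  have hz : B i₀ i₁ / A i₀ i₁ - B i₁ i₀ / A i₁ i₀ ≠ 0 := by
    rw [div_sub_div _ _ hA₂ hA₁]
    refine div_ne_zero (fun h => hc ?_) (mul_ne_zero hA₂ hA₁)
    linear_combination h
  set d : ι → 𝔽 := fun i => (e i - e i₀) *
    ((B i₀ i₁ / A i₀ i₁ - B i₁ i₀ / A i₁ i₀) / (e i₁ - e i₀)) + B i₁ i₀ / A i₁ i₀ with hd
  have hdi : Function.Injective d := fun i j hij =>
    he (sub_left_injective (mul_right_cancel₀ (div_ne_zero hz he') (add_right_cancel hij)))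
  have hd₀ : d i₀ * A i₁ i₀ = B i₁ i₀ := by
    simp only [hd, sub_self, zero_mul, zero_add]
    exact div_mul_cancel₀ _ hA₁
  have hd₁ : d i₁ * A i₀ i₁ = B i₀ i₁ := by
    simp only [hd]
    rw [mul_div_cancel₀ _ he', sub_add_cancel]
    exact div_mul_cancel₀ _ hA₂
  have hd₂ : d i₁ * A i₁ i₀ - B i₁ i₀ ≠ 0 := fun h => by
    have : (d i₁ - d i₀) * A i₁ i₀ = 0 := by linear_combination h - hd₀
    exact mul_ne_zero (sub_ne_zero.2 (hdi.ne hne)) hA₁ this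
  refine of_rows_replaced hD (fun i => i ≠ i₀ ∧ i ≠ i₁) (by simp) hdi ?_ fun k => ?_
  · intro h
    obtain ⟨v, hv0, hv⟩ := exists_mulVec_eq_zero_iff.2 h
    have hv1 : ∀ i, i ≠ i₀ ∧ i ≠ i₁ → v i = 0 := fun i hi => by
      simpa [mulVec, dotProduct, hi, one_apply] using congrFun hv i
    have h0 := congrFun hv i₀
    have h1 := congrFun hv i₁
    simp only [mulVec, dotProduct, of_apply, ne_eq, not_true_eq_false, false_and, and_false,
      if_false, Pi.zero_apply] at h0 h1
    rw [Fintype.sum_eq_add i₀ i₁ hne.symm fun i hi => by rw [hv1 i hi, mul_zero]] at h0 h1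
    rw [hA₀, zero_mul, zero_add] at h0
    have hvi₁ := (mul_eq_zero.1 h0).resolve_left hA₂
    rw [hvi₁, mul_zero, add_zero] at h1
    have hvi₀ := (mul_eq_zero.1 h1).resolve_left hA₁
    refine hv0 (funext fun i => ?_)
    by_cases hi : i = i₀
    · exact hi ▸ hvi₀
    by_cases hi' : i = i₁
    · exact hi' ▸ hvi₁
    exact hv1 i ⟨hi, hi'⟩
  · by_cases hk : k = i₀
    · subst hk
      refine det_eq_zero_of_column_eq_zero k fun i => ?_
      by_cases hi : i = k
      · subst hi
        simp [hA₀, hB₀]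
      by_cases hi' : i = i₁
      · subst hi'
        simp [hd₀]
      · simp [hi, hi']
    by_cases hk' : k = i₁
    · subst hk'
      refine exists_mulVec_eq_zero_iff.1
        ⟨Pi.single k (d k * A k i₀ - B k i₀) + Pi.single i₀ (-(d k * A k k - B k k)),
          fun h => hd₂ ?_, ?_⟩
      · simpa [hk] using congrFun h k
      · rw [mulVec_add]
        ext i
        by_cases hi : i = i₀
        · subst hi
          simp [hA₀, hB₀, hd₁]
        by_cases hi' : i = k
        · subst hi'
          simp
          ring
        · simp [hi, hi']
    · refine det_eq_zero_of_row_eq_zero k fun j => ?_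
      by_cases hj : k = j
      · subst hj
        simp [hk, hk']
      · simp [hk, hk', hj]

theorem of_cross_ne_zero {A B : Matrix ι ι 𝔽} {D : ι → 𝔽} {i₀ i₁ : ι}
    (hD : D i₀ = 0) (hA₀ : A i₀ i₀ = 0) (hB₀ : B i₀ i₀ = 0)
    (hc : A i₁ i₀ * B i₀ i₁ - B i₁ i₀ * A i₀ i₁ ≠ 0) :
    CoveredByRankOnes (2 * Fintype.card ι - 1) {A, B, diagonal D} := by
  obtain ⟨τ, h1, h2⟩ : ∃ τ : 𝔽, A i₁ i₀ + τ * B i₁ i₀ ≠ 0 ∧ A i₀ i₁ + τ * B i₀ i₁ ≠ 0 := by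
    by_contra! h
    have h0 := h 0
    have h1 := h 1
    have h2 := h (-1)
    have h3 : (2 : 𝔽) ≠ 0 := two_ne_zero
    simp only [zero_mul, add_zero, one_mul, neg_mul] at h0 h1 h2
    by_cases ha : A i₁ i₀ = 0
    · by_cases hb : B i₁ i₀ = 0
      · exact hc (by rw [ha, hb]; ring)
      · have e1 := h1 (by simpa [ha] using hb)
        have e2 := h2 (by simpa [ha] using hb)
        have e3 : A i₀ i₁ = 0 := by grind
        exact hc (by rw [ha, e3]; ring)
    · have e0 := h0 ha
      by_cases hd : B i₀ i₁ = 0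
      · exact hc (by rw [e0, hd]; ring)
      · have e1 : A i₁ i₀ + B i₁ i₀ = 0 := by
          by_contra h'
          exact hd (by simpa [e0] using h1 h')
        have e2 : A i₁ i₀ + -B i₁ i₀ = 0 := by
          by_contra h'
          exact hd (by simpa [e0] using h2 h')
        have e3 : (2 : 𝔽) * A i₁ i₀ = 0 := by linear_combination e1 + e2
        exact ha ((mul_eq_zero.1 e3).resolve_left h3)
  have h := of_cross_ne_zero_of_ne_zero (A := A + τ • B) (B := B) (i₁ := i₁) hD (by simp [*])
    hB₀ (by simpa using h1) (by simpa using h2) (by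
      simp only [Matrix.add_apply, Matrix.smul_apply, smul_eq_mul]
      intro h
      exact hc (by linear_combination h))
  refine h.triple_of_mem_span ?_ ?_ ?_
  · exact Submodule.mem_span_triple.2 ⟨1, -τ, 0, by simp⟩
  · exact Submodule.mem_span_triple.2 ⟨0, 1, 0, by simp⟩
  · exact Submodule.mem_span_triple.2 ⟨0, 0, 1, by simp⟩

theorem of_exists_cross_ne_zero {A B : Matrix ι ι 𝔽} {D : ι → 𝔽} {i₀ i j : ι}
    (hD : D i₀ = 0) (hA₀ : A i₀ i₀ = 0) (hB₀ : B i₀ i₀ = 0) (hij : D i = D j)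
    (hc : A i i₀ * B i₀ j - B i i₀ * A i₀ j ≠ 0) :
    CoveredByRankOnes (2 * Fintype.card ι - 1) {A, B, diagonal D} := by
  by_cases hi : A i i₀ * B i₀ i - B i i₀ * A i₀ i = 0
  swap
  · exact of_cross_ne_zero hD hA₀ hB₀ hi
  have hne : i ≠ j := by
    rintro rfl
    exact hc hi
  have hi₀ : i ≠ i₀ := by
    rintro rfl
    simp [hA₀, hB₀] at hc
  have hj₀ : j ≠ i₀ := by
    rintro rfl
    simp [hA₀, hB₀] at hc
  have hinv : ∀ c : 𝔽, transvection j i c * transvection j i (-c) = 1 := fun c => by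
    rw [transvection_mul_transvection_same _ _ hne.symm, add_neg_cancel, transvection_zero]
  have hinv' := hinv (-1)
  rw [neg_neg] at hinv'
  have hcol : ∀ M : Matrix ι ι 𝔽,
      (transvection j i (-1) * M * transvection j i 1 : Matrix ι ι 𝔽) i i₀ = M i i₀ := fun M => by
    rw [mul_transvection_apply_of_ne _ _ _ _ hi₀.symm, transvection_mul_apply_of_ne _ _ _ _ hne]
  have hrow : ∀ M : Matrix ι ι 𝔽,
      (transvection j i (-1) * M * transvection j i 1 : Matrix ι ι 𝔽) i₀ i =
        M i₀ i + M i₀ j := fun M => by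
    rw [mul_transvection_apply_same, transvection_mul_apply_of_ne _ _ _ _ hj₀.symm,
      transvection_mul_apply_of_ne _ _ _ _ hj₀.symm, one_mul]
  have hcor : ∀ M : Matrix ι ι 𝔽,
      (transvection j i (-1) * M * transvection j i 1 : Matrix ι ι 𝔽) i₀ i₀ =
        M i₀ i₀ := fun M => by
    rw [mul_transvection_apply_of_ne _ _ _ _ hi₀.symm,
      transvection_mul_apply_of_ne _ _ _ _ hj₀.symm]
  have hdiag : transvection j i (-1) * diagonal D * transvection j i 1 = diagonal D := by
    have : diagonal D * transvection j i 1 = transvection j i 1 * diagonal D := by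
      simp only [transvection, Matrix.mul_add, Matrix.add_mul, Matrix.mul_one, Matrix.one_mul]
      congr 1
      ext x y
      rw [diagonal_mul, mul_diagonal, single_apply]
      split_ifs with h
      · rw [← h.1, ← h.2, hij, mul_comm]
      · simp
    rw [Matrix.mul_assoc, this, ← Matrix.mul_assoc, hinv', Matrix.one_mul]
  refine of_mul_mul (hinv 1) (hinv 1) ?_
  rw [hdiag]
  refine of_cross_ne_zero (i₁ := i) hD (by rw [hcor, hA₀]) (by rw [hcor, hB₀]) ?_
  rw [hcol, hcol, hrow, hrow]
  intro h
  exact hc (by linear_combination h - hi)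

/-- The slices have a common zero column. -/
theorem of_column_eq_zero {A B : Matrix ι ι 𝔽} {D : ι → 𝔽} {i₀ : ι} (hD : D i₀ = 0)
    (hA : ∀ i, A i i₀ = 0) (hB : ∀ i, B i i₀ = 0) :
    CoveredByRankOnes (2 * Fintype.card ι - 1) {A, B, diagonal D} := by
  have h := (of_apply_self_ne_zero (A := A + single i₀ i₀ 1) (B := B) hD
    (by simp [hA])).triple_mul_mul (1 : Matrix ι ι 𝔽) (diagonal fun i => if i = i₀ then 0 else 1)
  have key : ∀ M : Matrix ι ι 𝔽, (∀ i, M i i₀ = 0) →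
      M * (diagonal fun i => if i = i₀ then 0 else 1) = M := fun M hM => by
    ext x y
    rw [mul_diagonal]
    split_ifs with hy
    · rw [hy, hM, mul_zero]
    · rw [mul_one]
  have hs : (single i₀ i₀ 1 : Matrix ι ι 𝔽) * (diagonal fun i => if i = i₀ then 0 else 1) = 0 := by
    ext x y
    rw [mul_diagonal, single_apply]
    by_cases hy : y = i₀
    · simp [hy]
    · simp [Ne.symm hy]
  have hDc : ∀ i, diagonal D i i₀ = 0 := fun i => by
    rw [diagonal_apply]
    split_ifs with hi
    · rw [hi, hD]
    · rfl
  rwa [Matrix.one_mul, Matrix.one_mul, Matrix.one_mul, Matrix.add_mul, key A hA, key B hB,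
    key _ hDc, hs, add_zero] at h

end RCLike

variable {𝔽 : Type*} [RCLike 𝔽]

/-- If row and column `i₀` vanish in `B` and `C`, then peeling off row and column `i₀` of `A`
costs two matrices of rank one, and leaves enough freedom to make the remaining part of `A`
singular. -/
theorem of_rows_columns_eq_zero {m : ℕ}
    (ih : ∀ A B C : Matrix (Fin m) (Fin m) 𝔽, C.det = 0 →
      CoveredByRankOnes (2 * m - 1) {A, B, C})
    {A B C : Matrix (Fin (m + 1)) (Fin (m + 1)) 𝔽} {i₀ : Fin (m + 1)} (hA₀ : A i₀ i₀ = 0)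
    (hB : ∀ i, B i i₀ = 0) (hB' : ∀ j, B i₀ j = 0) (hC : ∀ i, C i i₀ = 0)
    (hC' : ∀ j, C i₀ j = 0) {j₁ : Fin (m + 1)} (hv : A i₀ j₁ ≠ 0) :
    CoveredByRankOnes (2 * (m + 1) - 1) {A, B, C} := by
  obtain ⟨j, rfl⟩ : ∃ j, i₀.succAbove j = j₁ := by
    refine Fin.exists_succAbove_eq ?_
    rintro rfl
    exact hv hA₀
  have hm : 0 < m := j.pos
  set p : Fin (m + 1) → 𝔽 :=
    fun i => if i = i₀ then 1 else A i (i₀.succAbove j) / A i₀ (i₀.succAbove j) with hp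
  set R₁ := Matrix.vecMulVec p (A i₀) with hR₁
  set R₂ := Matrix.vecMulVec (fun i => A i i₀) (Pi.single i₀ (1 : 𝔽)) with hR₂
  set A' := A - R₁ - R₂ with hA'
  have hcol : ∀ i, A' i i₀ = 0 := fun i => by
    simp [hA', hR₁, hR₂, vecMulVec_apply, hA₀]
  have hrow : ∀ k, A' i₀ k = 0 := fun k => by
    simp [hA', hR₁, hR₂, hp, vecMulVec_apply, hA₀]
  have hzero : ∀ i, A' (i₀.succAbove i) (i₀.succAbove j) = 0 := fun i => by
    simp [hA', hR₁, hR₂, hp, vecMulVec_apply, Fin.succAbove_ne, hv]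
  set J : Matrix (Fin (m + 1)) (Fin m) 𝔽 := of fun i k => if i = i₀.succAbove k then 1 else 0
    with hJ
  have lift : ∀ N : Matrix (Fin (m + 1)) (Fin (m + 1)) 𝔽, (∀ i, N i i₀ = 0) → (∀ k, N i₀ k = 0) →
      J * N.submatrix i₀.succAbove i₀.succAbove * Jᵀ = N := fun N h h' => by
    ext x y
    revert y
    revert x
    have e1 : ∀ k, i₀ ≠ i₀.succAbove k := fun k => (Fin.succAbove_ne i₀ k).symm
    refine (Fin.forall_iff_succAbove i₀).2 ⟨fun y => ?_, fun x => ?_⟩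
    · simp [Matrix.mul_apply, hJ, e1, h']
    · refine (Fin.forall_iff_succAbove i₀).2 ⟨?_, fun y => ?_⟩
      · simp [Matrix.mul_apply, hJ, e1, h]
      · simp [Matrix.mul_apply, hJ]
  have hdet : (A'.submatrix i₀.succAbove i₀.succAbove).det = 0 :=
    det_eq_zero_of_column_eq_zero j hzero
  have h1 := (ih (B.submatrix i₀.succAbove i₀.succAbove) (C.submatrix i₀.succAbove i₀.succAbove)
    _ hdet).triple_mul_mul J Jᵀ
  rw [lift B hB hB', lift C hC hC', lift A' hcol hrow] at h1
  have h2 := (h1.union (vecMulVec p (A i₀))).union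
    (vecMulVec (fun i => A i i₀) (Pi.single i₀ (1 : 𝔽)))
  rw [← hR₁, ← hR₂] at h2
  rw [show 2 * m - 1 + 1 + 1 = 2 * (m + 1) - 1 by omega] at h2
  refine h2.of_subset_span
    (Set.insert_subset ?_ (Set.insert_subset ?_ (Set.singleton_subset_iff.2 ?_)))
  · have hAe : A = A' + R₁ + R₂ := by
      rw [hA']
      abel
    refine (congrArg (· ∈ Submodule.span 𝔽 _) hAe).mpr ?_
    refine add_mem (add_mem ?_ ?_) ?_ <;> exact Submodule.subset_span (by simp)
  · exact Submodule.subset_span (by simp)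
  · exact Submodule.subset_span (by simp)

/-- The column and row of index `i₀` in the slices are all proportional, respectively. -/
theorem of_cross_eq_zero {m : ℕ}
    (ih : ∀ A B C : Matrix (Fin m) (Fin m) 𝔽, C.det = 0 →
      CoveredByRankOnes (2 * m - 1) {A, B, C})
    {A B C : Matrix (Fin (m + 1)) (Fin (m + 1)) 𝔽} {i₀ : Fin (m + 1)} (hA₀ : A i₀ i₀ = 0)
    (hC : ∀ i, C i i₀ = 0) (hC' : ∀ j, C i₀ j = 0)
    (hcross : ∀ i j, A i i₀ * B i₀ j = B i i₀ * A i₀ j) {i : Fin (m + 1)} (hu : A i i₀ ≠ 0)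
    (hv : ∃ j, A i₀ j ≠ 0 ∨ B i₀ j ≠ 0) :
    CoveredByRankOnes (2 * (m + 1) - 1) {A, B, C} := by
  set κ := B i i₀ / A i i₀ with hκ
  have hrow : ∀ j, B i₀ j = κ * A i₀ j := fun j => by
    rw [hκ, div_mul_eq_mul_div, eq_div_iff hu, mul_comm, hcross]
  obtain ⟨j, hj⟩ : ∃ j, A i₀ j ≠ 0 := by
    obtain ⟨j, hj | hj⟩ := hv
    · exact ⟨j, hj⟩
    · exact ⟨j, fun h => hj (by rw [hrow, h, mul_zero])⟩
  have hcol : ∀ k, B k i₀ = κ * A k i₀ := fun k => by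
    refine mul_right_cancel₀ hj ?_
    rw [← hcross, hrow]
    ring
  have h := of_rows_columns_eq_zero ih (A := A) (B := B - κ • A) (C := C) hA₀
    (fun k => by simp [hcol]) (fun k => by simp [hrow]) hC hC' hj
  refine h.triple_of_mem_span ?_ ?_ ?_
  · exact Submodule.mem_span_triple.2 ⟨1, 0, 0, by simp⟩
  · exact Submodule.mem_span_triple.2 ⟨κ, 1, 0, by simp⟩
  · exact Submodule.mem_span_triple.2 ⟨0, 0, 1, by simp⟩

theorem exists_mul_mul_eq_diagonal {ι 𝕜 : Type*} [Field 𝕜] [Fintype ι] [DecidableEq ι]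
    (C : Matrix ι ι 𝕜) :
    ∃ (P P' Q Q' : Matrix ι ι 𝕜) (D : ι → 𝕜), P' * P = 1 ∧ Q * Q' = 1 ∧
      P * C * Q = diagonal D ∧ ∀ i, D i = 0 ∨ D i = 1 := by
  classical
  obtain ⟨L, L', D, h⟩ := Pivot.exists_list_transvec_mul_mul_list_transvec_eq_diagonal C
  set P := (L.map TransvectionStruct.toMatrix).prod
  set Q := (L'.map TransvectionStruct.toMatrix).prod
  have hP : IsUnit P.det := by simp [P]
  have hQ : IsUnit Q.det := by simp [Q]
  set s : ι → 𝕜 := fun i => if D i = 0 then 1 else D i with hs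
  have hs0 : ∀ i, s i ≠ 0 := fun i => by
    simp only [hs]
    split_ifs with hi
    · exact one_ne_zero
    · exact hi
  refine ⟨P, P⁻¹, Q * diagonal (fun i => (s i)⁻¹), diagonal s * Q⁻¹, fun i => D i * (s i)⁻¹,
    nonsing_inv_mul _ hP, ?_, ?_, fun i => ?_⟩
  · rw [Matrix.mul_assoc, ← Matrix.mul_assoc (diagonal _), diagonal_mul_diagonal]
    simp [hs0, mul_nonsing_inv _ hQ]
  · rw [← Matrix.mul_assoc, h, diagonal_mul_diagonal]
  · by_cases hi : D i = 0
    · simp [hi]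
    · simp [hs, hi]

theorem of_det_eq_zero {n : ℕ} (A B C : Matrix (Fin n) (Fin n) 𝔽) (hC : C.det = 0) :
    CoveredByRankOnes (2 * n - 1) {A, B, C} := by
  induction n with
  | zero => simp at hC
  | succ m ih =>
    obtain ⟨P, P', Q, Q', D, hP, hQ, hD, hD01⟩ := exists_mul_mul_eq_diagonal C
    refine of_mul_mul hP hQ ?_
    obtain ⟨i₀, hi₀⟩ : ∃ i₀, D i₀ = 0 := by
      have : (diagonal D).det = 0 := by rw [← hD, det_mul, det_mul, hC, mul_zero, zero_mul]
      rw [det_diagonal, Finset.prod_eq_zero_iff] at this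
      obtain ⟨i, -, hi⟩ := this
      exact ⟨i, hi⟩
    rw [hD]
    generalize P * A * Q = A
    generalize P * B * Q = B
    have hcard : 2 * (m + 1) - 1 = 2 * Fintype.card (Fin (m + 1)) - 1 := by simp
    have hcol : ∀ i, diagonal D i i₀ = 0 := fun i => by
      by_cases h : i = i₀
      · simp [h, hi₀]
      · simp [h]
    have hrow : ∀ j, diagonal D i₀ j = 0 := fun j => by
      by_cases h : i₀ = j
      · simp [← h, hi₀]
      · simp [h]
    by_cases hA : ∃ i j, D i = 0 ∧ D j = 0 ∧ A i j ≠ 0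
    · obtain ⟨i, j, hi, hj, h⟩ := hA
      rw [hcard]
      exact of_apply_ne_zero hi hj h
    by_cases hB : ∃ i j, D i = 0 ∧ D j = 0 ∧ B i j ≠ 0
    · obtain ⟨i, j, hi, hj, h⟩ := hB
      rw [hcard, Set.insert_comm]
      exact of_apply_ne_zero hi hj h
    push Not at hA hB
    by_cases hc : ∃ i j, A i i₀ * B i₀ j - B i i₀ * A i₀ j ≠ 0
    · obtain ⟨i, j, h⟩ := hc
      have hi : D i = 1 := (hD01 i).resolve_left fun hi => h (by
        rw [hA i i₀ hi hi₀, hB i i₀ hi hi₀]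
        ring)
      have hj : D j = 1 := (hD01 j).resolve_left fun hj => h (by
        rw [hA i₀ j hi₀ hj, hB i₀ j hi₀ hj]
        ring)
      rw [hcard]
      exact of_exists_cross_ne_zero hi₀ (hA _ _ hi₀ hi₀) (hB _ _ hi₀ hi₀) (hi.trans hj.symm) h
    push Not at hc
    have hc' : ∀ i j, A i i₀ * B i₀ j = B i i₀ * A i₀ j := fun i j => sub_eq_zero.1 (hc i j)
    by_cases hv : ∃ j, A i₀ j ≠ 0 ∨ B i₀ j ≠ 0
    swap
    · push Not at hv
      have h := (of_column_eq_zero (A := Aᵀ) (B := Bᵀ) hi₀ (fun j => (hv j).1)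
        (fun j => (hv j).2)).transpose
      rw [hcard]
      simpa using h
    by_cases hu : ∃ i, A i i₀ ≠ 0
    · obtain ⟨i, hi⟩ := hu
      exact of_cross_eq_zero ih (hA _ _ hi₀ hi₀) hcol hrow hc' hi hv
    by_cases hu' : ∃ i, B i i₀ ≠ 0
    · obtain ⟨i, hi⟩ := hu'
      rw [Set.insert_comm]
      exact of_cross_eq_zero ih (hB _ _ hi₀ hi₀) hcol hrow (fun i j => (hc' i j).symm) hi
        (hv.imp fun _ => Or.symm)
    push Not at hu hu'
    rw [hcard]
    exact of_column_eq_zero hi₀ hu hu'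

end CoveredByRankOnes

/-- Let `𝔽` be `ℝ` or `ℂ` and `T = (A 0; A 1; A 2)` an `n × n × 3` tensor over `𝔽`.
If the linear span of the three slices contains a nonzero singular matrix, then
`T` has rank at most `2 * n - 1`. -/
theorem stmt18 {𝔽 : Type*} [RCLike 𝔽] {n : ℕ} (hn : 0 < n)
    (T : Fin 3 → Matrix (Fin n) (Fin n) 𝔽)
    (hsing : ∃ M ∈ Submodule.span 𝔽 {T 0, T 1, T 2}, M ≠ 0 ∧ M.det = 0) :
    tensorRank 𝔽 T ≤ 2 * n - 1 := by
  obtain ⟨M, hM, hM0, hdet⟩ := hsing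
  obtain ⟨x, y, z, rfl⟩ := Submodule.mem_span_triple.1 hM
  have hcov : CoveredByRankOnes (2 * n - 1) {T 0, T 1, T 2} := by
    by_cases hx : x = 0
    · by_cases hy : y = 0
      · have hz : z ≠ 0 := by
          rintro rfl
          simp [hx, hy] at hM0
        refine (CoveredByRankOnes.of_det_eq_zero (T 0) (T 1) _ hdet).triple_of_mem_span ?_ ?_ ?_
        · exact Submodule.mem_span_triple.2 ⟨1, 0, 0, by simp⟩
        · exact Submodule.mem_span_triple.2 ⟨0, 1, 0, by simp⟩
        · exact Submodule.mem_span_triple.2 ⟨0, 0, z⁻¹, by simp [hx, hy, smul_smul, hz]⟩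
      · refine (CoveredByRankOnes.of_det_eq_zero (T 0) (T 2) _ hdet).triple_of_mem_span ?_ ?_ ?_
        · exact Submodule.mem_span_triple.2 ⟨1, 0, 0, by simp⟩
        · refine Submodule.mem_span_triple.2 ⟨0, -(y⁻¹ * z), y⁻¹, ?_⟩
          simp [hx, smul_smul, hy]
        · exact Submodule.mem_span_triple.2 ⟨0, 1, 0, by simp⟩
    · refine (CoveredByRankOnes.of_det_eq_zero (T 1) (T 2) _ hdet).triple_of_mem_span ?_ ?_ ?_
      · refine Submodule.mem_span_triple.2 ⟨-(x⁻¹ * y), -(x⁻¹ * z), x⁻¹, ?_⟩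
        simp only [smul_add, smul_smul, inv_mul_cancel₀ hx]
        module
      · exact Submodule.mem_span_triple.2 ⟨1, 0, 0, by simp⟩
      · exact Submodule.mem_span_triple.2 ⟨0, 1, 0, by simp⟩
  obtain ⟨a, b, hab⟩ := hcov
  have hT : ∀ k, ∃ c : Fin (2 * n - 1) → 𝔽, ∑ i, c i • Matrix.vecMulVec (a i) (b i) = T k := by
    intro k
    refine (Submodule.mem_span_range_iff_exists_fun 𝔽).1 (hab ?_)
    fin_cases k <;> simp
  choose c hc using hT
  exact Nat.sInf_le ⟨a, b, fun i k => c k i, fun k => (hc k).symm⟩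
end

section
/- Let n be an odd positive integer. Then max.rank_ℝ(n,n,3) ≤ 2n − 1; that is, every n×n×3 tensor over the real numbers has rank at most 2n − 1 when n is odd. -/
open Matrix

/-- The tensor with slices `A`, `B`, `C` has rank at most `r`. -/
def RankLE {m n : Type} (r : ℕ) (A B C : Matrix m n ℝ) : Prop :=
  ∃ (ι : Type) (_ : Fintype ι) (_ : DecidableEq ι) (P : Matrix m ι ℝ) (Q : Matrix ι n ℝ)
    (α β γ : ι → ℝ), Fintype.card ι ≤ r ∧
      A = P * diagonal α * Q ∧ B = P * diagonal β * Q ∧ C = P * diagonal γ * Q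

namespace RankLE

variable {m n : Type} {r s : ℕ} {A B C A' B' C' : Matrix m n ℝ}

theorem mono (h : RankLE r A B C) (hrs : r ≤ s) : RankLE s A B C := by
  obtain ⟨ι, i₁, i₂, P, Q, α, β, γ, hc, h⟩ := h
  exact ⟨ι, i₁, i₂, P, Q, α, β, γ, hc.trans hrs, h⟩

theorem add (h : RankLE r A B C) (h' : RankLE s A' B' C') :
    RankLE (r + s) (A + A') (B + B') (C + C') := by
  obtain ⟨ι, _, _, P, Q, α, β, γ, hc, rfl, rfl, rfl⟩ := h
  obtain ⟨κ, _, _, P', Q', α', β', γ', hc', rfl, rfl, rfl⟩ := h'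
  refine ⟨ι ⊕ κ, inferInstance, inferInstance, fromCols P P', fromRows Q Q', Sum.elim α α',
    Sum.elim β β', Sum.elim γ γ', by simpa using add_le_add hc hc', ?_, ?_, ?_⟩ <;>
  simp [← fromBlocks_diagonal, fromCols_mul_fromBlocks, fromCols_mul_fromRows]

theorem mul_mul {m' n' : Type} [Fintype m] [Fintype n] (h : RankLE r A B C)
    (L : Matrix m' m ℝ) (R : Matrix n n' ℝ) : RankLE r (L * A * R) (L * B * R) (L * C * R) := by
  obtain ⟨ι, i₁, i₂, P, Q, α, β, γ, hc, rfl, rfl, rfl⟩ := h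
  exact ⟨ι, i₁, i₂, L * P, Q * R, α, β, γ, hc, by simp only [Matrix.mul_assoc],
    by simp only [Matrix.mul_assoc], by simp only [Matrix.mul_assoc]⟩

theorem transpose (h : RankLE r A B C) : RankLE r Aᵀ Bᵀ Cᵀ := by
  obtain ⟨ι, i₁, i₂, P, Q, α, β, γ, hc, rfl, rfl, rfl⟩ := h
  exact ⟨ι, i₁, i₂, Qᵀ, Pᵀ, α, β, γ, hc, by simp [Matrix.mul_assoc],
    by simp [Matrix.mul_assoc], by simp [Matrix.mul_assoc]⟩

theorem swap (h : RankLE r A B C) : RankLE r B A C := by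
  obtain ⟨ι, i₁, i₂, P, Q, α, β, γ, hc, hA, hB, hC⟩ := h
  exact ⟨ι, i₁, i₂, P, Q, β, α, γ, hc, hB, hA, hC⟩

theorem rotate (h : RankLE r A B C) : RankLE r B C A := by
  obtain ⟨ι, i₁, i₂, P, Q, α, β, γ, hc, hA, hB, hC⟩ := h
  exact ⟨ι, i₁, i₂, P, Q, β, γ, α, hc, hB, hC, hA⟩

theorem add_smul (h : RankLE r A B C) (x : ℝ) : RankLE r A B (C + x • A) := by
  obtain ⟨ι, i₁, i₂, P, Q, α, β, γ, hc, rfl, rfl, rfl⟩ := h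
  refine ⟨ι, i₁, i₂, P, Q, α, β, γ + x • α, hc, rfl, rfl, ?_⟩
  have : Matrix.diagonal (γ + x • α) = Matrix.diagonal γ + x • Matrix.diagonal α := by
    rw [← diagonal_smul, diagonal_add]; rfl
  simp [this, Matrix.mul_add, Matrix.add_mul]

theorem of_sum {ι : Type} [Fintype ι] (u : ι → m → ℝ) (v : ι → n → ℝ) (α β γ : ι → ℝ) :
    RankLE (Fintype.card ι) (∑ i, α i • vecMulVec (u i) (v i))
      (∑ i, β i • vecMulVec (u i) (v i)) (∑ i, γ i • vecMulVec (u i) (v i)) := by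
  classical
  refine ⟨ι, inferInstance, inferInstance, of fun j i => u i j, of v, α, β, γ, le_rfl, ?_, ?_, ?_⟩ <;>
  · ext i j
    simp [Matrix.sum_apply, Matrix.mul_apply, vecMulVec_apply, diagonal_apply]
    exact Finset.sum_congr rfl fun _ _ => by ring

theorem exists_sum (h : RankLE r A B C) : ∃ (k : ℕ) (u : Fin k → m → ℝ) (v : Fin k → n → ℝ)
    (α β γ : Fin k → ℝ), k ≤ r ∧ A = ∑ i, α i • vecMulVec (u i) (v i) ∧
      B = ∑ i, β i • vecMulVec (u i) (v i) ∧ C = ∑ i, γ i • vecMulVec (u i) (v i) := by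
  obtain ⟨ι, _, _, P, Q, α, β, γ, hc, rfl, rfl, rfl⟩ := h
  let e := (Fintype.equivFin ι).symm
  refine ⟨Fintype.card ι, fun i => Pᵀ (e i), fun i => Q (e i), α ∘ e, β ∘ e, γ ∘ e, hc, ?_, ?_, ?_⟩ <;>
  · ext i j
    simp only [Matrix.sum_apply, Matrix.mul_apply, Matrix.smul_apply, vecMulVec_apply,
      Function.comp_apply, transpose_apply, diagonal_apply, mul_ite, mul_zero, smul_eq_mul,
      Finset.sum_ite_eq', Finset.mem_univ, if_true]
    rw [← e.sum_comp]
    exact Finset.sum_congr rfl fun _ _ => by ring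

theorem vecMulVec (u : m → ℝ) (v : n → ℝ) (α β γ : ℝ) :
    RankLE 1 (α • Matrix.vecMulVec u v) (β • Matrix.vecMulVec u v)
      (γ • Matrix.vecMulVec u v) := by
  simpa using of_sum (fun _ : Unit => u) (fun _ => v) (fun _ => α) (fun _ => β) (fun _ => γ)

theorem diagonal [Fintype n] [DecidableEq n] (i₀ : n) (d e f : n → ℝ)
    (hd : d i₀ = 0) (he : e i₀ = 0) (hf : f i₀ = 0) :
    RankLE (Fintype.card n - 1) (diagonal d) (diagonal e) (diagonal f) := by
  have key (d : n → ℝ) (hd : d i₀ = 0) : Matrix.diagonal d = ∑ i : {i // i ≠ i₀},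
      d i • Matrix.vecMulVec (Pi.single (i : n) (1 : ℝ)) (Pi.single (i : n) (1 : ℝ)) := by
    have : ∑ i : {i // i ≠ i₀}, d i • Matrix.vecMulVec (Pi.single (i : n) (1 : ℝ))
        (Pi.single (i : n) (1 : ℝ)) =
        ∑ i, d i • Matrix.vecMulVec (Pi.single i (1 : ℝ)) (Pi.single i (1 : ℝ)) := by
      rw [← Fintype.sum_subtype_add_sum_subtype (· ≠ i₀), left_eq_add]
      refine Finset.sum_eq_zero fun i _ => ?_
      rw [not_not.1 i.2, hd, zero_smul]
    rw [this]
    ext i j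
    simp only [Matrix.sum_apply, Matrix.smul_apply, vecMulVec_apply, diagonal_apply,
      Pi.single_apply]
    rcases eq_or_ne i j with rfl | h <;> simp_all
  rw [key d hd, key e he, key f hf]
  convert of_sum (fun i : {i // i ≠ i₀} => Pi.single (i : n) (1 : ℝ))
    (fun i : {i // i ≠ i₀} => Pi.single (i : n) (1 : ℝ)) (fun i => d i) (fun i => e i)
    (fun i => f i) using 1
  simp [Fintype.card_subtype_compl]


theorem submatrix {m' n' : Type} (h : RankLE r A B C) (e : m' → m) (f : n' → n) :
    RankLE r (A.submatrix e f) (B.submatrix e f) (C.submatrix e f) := by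
  obtain ⟨ι, i₁, i₂, P, Q, α, β, γ, hc, rfl, rfl, rfl⟩ := h
  exact ⟨ι, i₁, i₂, P.submatrix e id, Q.submatrix id f, α, β, γ, hc, rfl, rfl, rfl⟩

theorem of_submatrix_ne [DecidableEq n] {A B C : Matrix n n ℝ} (i₀ : n)
    (h : RankLE r (A.submatrix ((↑) : {i // i ≠ i₀} → n) ((↑) : {i // i ≠ i₀} → n))
      (B.submatrix (↑) (↑)) (C.submatrix (↑) (↑)))
    (hA : ∀ i, A i i₀ = 0) (hA' : ∀ i, A i₀ i = 0) (hB : ∀ i, B i i₀ = 0)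
    (hB' : ∀ i, B i₀ i = 0) (hC : ∀ i, C i i₀ = 0) (hC' : ∀ i, C i₀ i = 0) :
    RankLE r A B C := by
  obtain ⟨ι, i₁, i₂, P, Q, α, β, γ, hc, eA, eB, eC⟩ := h
  have key (A : Matrix n n ℝ) (α : ι → ℝ)
      (eA : A.submatrix (↑) (↑) = P * Matrix.diagonal α * Q)
      (hA : ∀ i, A i i₀ = 0) (hA' : ∀ i, A i₀ i = 0) :
      A = (of fun i k => if h : i ≠ i₀ then P ⟨i, h⟩ k else 0) * Matrix.diagonal α *
        (of fun k j => if h : j ≠ i₀ then Q k ⟨j, h⟩ else 0) := by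
    ext i j
    by_cases hi : i = i₀
    · subst hi; simp [Matrix.mul_apply, hA']
    by_cases hj : j = i₀
    · subst hj; simp [Matrix.mul_apply, hA]
    have := congrFun₂ eA ⟨i, hi⟩ ⟨j, hj⟩
    simpa [Matrix.mul_apply, hi, hj] using this
  exact ⟨ι, i₁, i₂, _, _, α, β, γ, hc, key A α eA hA hA', key B β eB hB hB', key C γ eC hC hC'⟩

variable [Fintype n] [DecidableEq n]

/-- A regular real pencil with pairwise distinct real eigenvalues is diagonalizable. -/
theorem of_det_eq_zero {M N : Matrix n n ℝ} (hM : M.det ≠ 0) {l : n → ℝ}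
    (hl : Function.Injective l) (h : ∀ i, (l i • M - N).det = 0) :
    RankLE (Fintype.card n) M N 0 := by
  choose v hv0 hv using fun i => exists_mulVec_eq_zero_iff.2 (h i)
  have hMu : IsUnit M.det := hM.isUnit
  have hv' (i) : N *ᵥ v i = l i • (M *ᵥ v i) := by
    have := hv i
    rw [sub_mulVec, smul_mulVec, sub_eq_zero] at this
    exact this.symm
  have hli : LinearIndependent ℝ v := by
    refine Module.End.eigenvectors_linearIndependent' (toLin' (M⁻¹ * N)) l hl v fun i => ?_
    rw [Module.End.hasEigenvector_iff, Module.End.mem_eigenspace_iff]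
    refine ⟨?_, hv0 i⟩
    rw [toLin'_apply, ← mulVec_mulVec, hv', mulVec_smul, mulVec_mulVec,
      nonsing_inv_mul _ hMu, one_mulVec]
  let V : Matrix n n ℝ := of fun i j => v j i
  have hV : IsUnit V.det :=
    (isUnit_iff_isUnit_det _).1 (linearIndependent_cols_iff_isUnit.1 hli)
  have hNV : N * V = M * V * Matrix.diagonal l := by
    ext i j
    have := congrFun (hv' j) i
    rw [mul_diagonal, mul_comm]
    exact this
  refine ⟨n, inferInstance, inferInstance, M * V, V⁻¹, 1, l, 0, le_rfl, ?_, ?_, ?_⟩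
  · rw [show Matrix.diagonal (1 : n → ℝ) = 1 from diagonal_one, Matrix.mul_one,
      Matrix.mul_assoc, mul_nonsing_inv _ hV, Matrix.mul_one]
  · rw [← hNV, Matrix.mul_assoc, mul_nonsing_inv _ hV, Matrix.mul_one]
  · rw [show Matrix.diagonal (0 : n → ℝ) = 0 from diagonal_zero]; simp

open Filter Topology

/-- Having only simple real eigenvalues is an open condition on pencils. -/
theorem eventually_of_det_eq_prod {M N : ℝ → Matrix n n ℝ} (hM : Continuous M)
    (hN : Continuous N) (hM₀ : (M 0).det ≠ 0) {r : n → ℝ} (hr : Function.Injective r) {μ : ℝ}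
    (hμ : μ ≠ 0) (hp : ∀ x : ℝ, (x • M 0 - N 0).det = μ * ∏ i, (x - r i)) :
    ∀ᶠ ε in 𝓝 0, RankLE (Fintype.card n) (M ε) (N ε) 0 := by
  obtain ⟨δ, hδ, hδ₀⟩ : ∃ δ : ℝ, (∀ i j, i ≠ j → 2 * δ < |r i - r j|) ∧ 0 < δ := by
    have h : ∀ᶠ δ : ℝ in 𝓝 0, ∀ i j, i ≠ j → 2 * δ < |r i - r j| := by
      simp only [eventually_all]
      intro i j hij
      refine ContinuousAt.eventually_lt (by fun_prop) continuousAt_const ?_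
      simpa [sub_eq_zero] using hr.ne hij
    exact ((h.filter_mono nhdsWithin_le_nhds).and self_mem_nhdsWithin).exists (f := 𝓝[>] (0 : ℝ))
  have hsign (i : n) : (∏ j, (r i - δ - r j)) * ∏ j, (r i + δ - r j) < 0 := by
    rw [← Finset.prod_mul_distrib, ← Finset.mul_prod_erase _ _ (Finset.mem_univ i)]
    refine mul_neg_of_neg_of_pos (by nlinarith) (Finset.prod_pos fun j hj => ?_)
    have h1 := hδ i j (Finset.ne_of_mem_erase hj).symm
    have h2 := sq_abs (r i - r j)
    nlinarith [abs_nonneg (r i - r j)]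
  have hdet (x : ℝ) : Continuous fun ε => (x • M ε - N ε).det := by fun_prop
  have hev : ∀ᶠ ε in 𝓝 (0 : ℝ), ∀ i,
      ((r i - δ) • M ε - N ε).det * ((r i + δ) • M ε - N ε).det < 0 := by
    rw [eventually_all]
    intro i
    refine ContinuousAt.eventually_lt ((hdet _).mul (hdet _)).continuousAt continuousAt_const ?_
    rw [hp, hp]
    have := mul_neg_of_pos_of_neg (mul_self_pos.2 hμ) (hsign i)
    linarith
  filter_upwards [hev, (hM.matrix_det.continuousAt.eventually_ne hM₀)] with ε h h'
  have hroot (i : n) : ∃ l ∈ Set.uIcc (r i - δ) (r i + δ), (l • M ε - N ε).det = 0 := by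
    refine intermediate_value_uIcc (f := fun x : ℝ => (x • M ε - N ε).det)
      (Continuous.continuousOn (by fun_prop)) ?_
    rw [Set.mem_uIcc]
    rcases mul_neg_iff.1 (h i) with h | h
    · exact Or.inr ⟨h.2.le, h.1.le⟩
    · exact Or.inl ⟨h.1.le, h.2.le⟩
  choose l hl hl' using hroot
  refine of_det_eq_zero h' (fun i j hij => ?_) hl'
  by_contra hne
  have h1 := hl i
  have h2 := hl j
  rw [Set.uIcc_of_le (by linarith)] at h1 h2
  rw [hij] at h1
  have := hδ i j hne
  rcases lt_abs.1 this with h | h <;> linarith [h1.1, h1.2, h2.1, h2.2]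

theorem _root_.Matrix.det_updateRow_diagonal (v b : n → ℝ) (i₀ : n) :
    ((Matrix.diagonal v).updateRow i₀ b).det = (∏ j ∈ Finset.univ.erase i₀, v j) * b i₀ := by
  rw [← cramer_transpose_apply, diagonal_transpose, cramer_eq_adjugate_mulVec, adjugate_diagonal,
    mulVec_diagonal]

/-- Adding a large diagonal pencil outside of position `i₀` makes a pencil diagonalizable. -/
theorem exists_add_smul_diagonal {A B : Matrix n n ℝ} {i₀ : n} {d r : n → ℝ} (hd₀ : d i₀ = 0)
    (hd : ∀ i ≠ i₀, d i ≠ 0) (hr : Function.Injective r) (hA : A i₀ i₀ ≠ 0)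
    (hB : B i₀ i₀ = r i₀ * A i₀ i₀) :
    ∃ t : ℝ, t ≠ 0 ∧ RankLE (Fintype.card n) (A + Matrix.diagonal (t • d))
      (B + Matrix.diagonal (t • (r * d))) 0 := by
  let S (ε : ℝ) : Matrix n n ℝ := Matrix.diagonal fun i => if i = i₀ then 1 else ε
  have hS : Continuous S := by
    refine Continuous.matrix_diagonal (continuous_pi fun i => ?_)
    split_ifs <;> fun_prop
  have hlim (X : Matrix n n ℝ) (v : n → ℝ) (hv : v i₀ = 0) :
      S 0 * X + Matrix.diagonal v = (Matrix.diagonal v).updateRow i₀ (X i₀) := by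
    ext i j
    rcases eq_or_ne i i₀ with rfl | hi
    · rcases eq_or_ne i j with rfl | hij <;> simp [S, diagonal_mul, *]
    · simp [S, diagonal_mul, hi]
  have hscale (X : Matrix n n ℝ) (v : n → ℝ) (hv : v i₀ = 0) {ε : ℝ} (hε : ε ≠ 0) :
      S ε⁻¹ * (S ε * X + Matrix.diagonal v) = X + Matrix.diagonal (ε⁻¹ • v) := by
    ext i j
    rcases eq_or_ne i i₀ with rfl | hi
    · rcases eq_or_ne i j with rfl | hij <;> simp [S, diagonal_mul, *]
    · rcases eq_or_ne i j with rfl | hij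
      · simp [S, diagonal_mul, hi]
        field_simp
      · simp [S, diagonal_mul, *]
  have hsub (v w : n → ℝ) :
      Matrix.diagonal (v - w) = Matrix.diagonal v - Matrix.diagonal w := (diagonal_sub v w).symm
  have h0 : ∏ j ∈ Finset.univ.erase i₀, d j ≠ 0 :=
    Finset.prod_ne_zero_iff.2 fun j hj => hd j (Finset.ne_of_mem_erase hj)
  have hev := eventually_of_det_eq_prod (M := fun ε => S ε * A + Matrix.diagonal d)
    (N := fun ε => S ε * B + Matrix.diagonal (r * d)) (by fun_prop) (by fun_prop)
    (by rw [hlim _ _ hd₀, det_updateRow_diagonal]; exact mul_ne_zero h0 hA) hr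
    (mul_ne_zero h0 hA) fun x => by
      have : x • (S 0 * A + Matrix.diagonal d) - (S 0 * B + Matrix.diagonal (r * d)) =
          S 0 * (x • A - B) + Matrix.diagonal (x • d - r * d) := by
        rw [hsub, diagonal_smul, Matrix.mul_sub, Matrix.mul_smul, smul_add]
        abel
      rw [this, hlim _ _ (by simp [hd₀]), det_updateRow_diagonal,
        ← Finset.mul_prod_erase _ _ (Finset.mem_univ i₀)]
      have : ∀ j, (x • d - r * d) j = d j * (x - r j) := fun j => by simp; ring
      simp only [this, Finset.prod_mul_distrib, Matrix.sub_apply, Matrix.smul_apply, hB,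
        smul_eq_mul]
      ring
  obtain ⟨ε, h, hε⟩ := ((hev.filter_mono nhdsWithin_le_nhds).and self_mem_nhdsWithin).exists
    (f := 𝓝[>] (0 : ℝ))
  have hε : ε ≠ 0 := ne_of_gt hε
  refine ⟨ε⁻¹, inv_ne_zero hε, ?_⟩
  have := h.mul_mul (S ε⁻¹) (1 : Matrix n n ℝ)
  rwa [hscale _ _ hd₀ hε, hscale _ (r * d) (by simp [hd₀]) hε, Matrix.mul_zero, Matrix.zero_mul,
    Matrix.mul_one, Matrix.mul_one] at this

theorem of_add_diagonal {A B : Matrix n n ℝ} {i₀ : n} {d e c : n → ℝ} (hd : d i₀ = 0)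
    (he : e i₀ = 0) (hc : c i₀ = 0)
    (h : RankLE (Fintype.card n) (A + Matrix.diagonal d) (B + Matrix.diagonal e) 0) :
    RankLE (2 * Fintype.card n - 1) A B (Matrix.diagonal c) := by
  have h1 := h.add (RankLE.diagonal i₀ (-d) (-e) c (by simp [hd]) (by simp [he]) hc)
  have hneg (v : n → ℝ) : Matrix.diagonal (-v) = -Matrix.diagonal v := (diagonal_neg v).symm
  rw [hneg, hneg, add_neg_cancel_right, add_neg_cancel_right, zero_add] at h1
  have : 0 < Fintype.card n := Fintype.card_pos_iff.2 ⟨i₀⟩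
  exact h1.mono (by omega)

theorem _root_.exists_injective_eq {ι : Type} [Fintype ι] (i₀ : ι) (x : ℝ) :
    ∃ r : ι → ℝ, Function.Injective r ∧ r i₀ = x := by
  let f : ι → ℝ := fun i => (Fintype.equivFin ι i : ℕ)
  have hf : Function.Injective f := fun i j h => by
    simpa [f, Fin.val_inj] using h
  exact ⟨fun i => f i - f i₀ + x, fun i j h => hf (by simpa using h), by simp⟩

theorem of_diagonal {A B : Matrix n n ℝ} {c : n → ℝ} {i₀ : n} (hc : c i₀ = 0)
    (hA : A i₀ i₀ ≠ 0) : RankLE (2 * Fintype.card n - 1) A B (Matrix.diagonal c) := by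
  obtain ⟨r, hr, hr₀⟩ := exists_injective_eq i₀ (B i₀ i₀ / A i₀ i₀)
  obtain ⟨t, -, h⟩ := exists_add_smul_diagonal (A := A) (B := B) (i₀ := i₀)
    (d := fun i => if i = i₀ then 0 else 1) (by simp) (by simp +contextual) hr hA
    (by rw [hr₀]; field_simp)
  exact of_add_diagonal (i₀ := i₀) (by simp) (by simp) hc h

theorem of_diagonal_of_row {A B : Matrix n n ℝ} {c d r s : n → ℝ} {i₀ : n} (hc : c i₀ = 0)
    (hd₀ : d i₀ = 0) (hd : ∀ i ≠ i₀, d i ≠ 0) (hr : Function.Injective r) (hs : s i₀ = 0)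
    (hA : ∀ j, A i₀ j = s j * d j) (hB : ∀ j, B i₀ j = s j * (r j * d j))
    (hsA : (s ᵥ* A) i₀ ≠ 0) (hsB : (s ᵥ* B) i₀ = r i₀ * (s ᵥ* A) i₀) :
    RankLE (2 * Fintype.card n - 1) A B (Matrix.diagonal c) := by
  obtain ⟨t, ht, h⟩ := exists_add_smul_diagonal (A := A.updateRow i₀ (-(s ᵥ* A)))
    (B := B.updateRow i₀ (-(s ᵥ* B))) hd₀ hd hr (by simpa using hsA) (by simp [hsB])
  refine of_add_diagonal (i₀ := i₀) (d := t • d) (e := t • (r * d)) (by simp [hd₀])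
    (by simp [hd₀]) hc ?_
  have key (X : Matrix n n ℝ) (v : n → ℝ) (hX : ∀ j, X i₀ j = s j * v j) (hv : v i₀ = 0) :
      (1 : Matrix n n ℝ).updateRow i₀ (t⁻¹ • (s + Pi.single i₀ 1)) *
        (X.updateRow i₀ (-(s ᵥ* X)) + Matrix.diagonal (t • v)) =
          X + Matrix.diagonal (t • v) := by
    rw [updateRow_mul, Matrix.one_mul]
    ext i j
    rcases eq_or_ne i i₀ with rfl | hi
    · have hz : s ᵥ* X.updateRow i (-(s ᵥ* X)) = s ᵥ* X := by
        ext j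
        refine Finset.sum_congr rfl fun k _ => ?_
        rcases eq_or_ne k i with rfl | hk <;> simp [*]
      rw [updateRow_self, smul_vecMul, add_vecMul, vecMul_add, vecMul_add, hz]
      simp [hX, hv, diagonal_apply]
      rw [vecMul_smul, Pi.smul_apply, vecMul_diagonal, smul_eq_mul]
      field_simp
    · simp [hi]
  have := h.mul_mul ((1 : Matrix n n ℝ).updateRow i₀ (t⁻¹ • (s + Pi.single i₀ 1)))
    (1 : Matrix n n ℝ)
  rwa [key _ _ hA hd₀, key _ (r * d) hB (by simp [hd₀]), Matrix.mul_zero, Matrix.zero_mul,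
    Matrix.mul_one, Matrix.mul_one] at this

/-- A vector space has a basis whose elements avoid the kernel of `f`, with the quotient `h / g`
taking distinct finite values outside a given finite set on its elements. -/
theorem _root_.exists_linearIndependent_forall_ne {κ ζ : Type} [Fintype κ] [Finite ζ]
    {f g h : Module.Dual ℝ (κ → ℝ)} (hf : f ≠ 0) (hg : g ≠ 0) (hgh : ∀ x : ℝ, h ≠ x • g)
    (e : ζ → ℝ) :
    ∃ v : κ → κ → ℝ, LinearIndependent ℝ v ∧ (∀ i, f (v i) ≠ 0) ∧ (∀ i, g (v i) ≠ 0) ∧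
      (∀ i z, h (v i) / g (v i) ≠ e z) ∧ Function.Injective fun i => h (v i) / g (v i) := by
  classical
  suffices H : ∀ t : Finset κ, ∃ v : κ → κ → ℝ, LinearIndepOn ℝ v (t : Set κ) ∧
      (∀ i ∈ t, f (v i) ≠ 0) ∧ (∀ i ∈ t, g (v i) ≠ 0) ∧
      (∀ i ∈ t, ∀ z, h (v i) / g (v i) ≠ e z) ∧
      Set.InjOn (fun i => h (v i) / g (v i)) (t : Set κ) by
    obtain ⟨v, h1, h2, h3, h4, h5⟩ := H Finset.univ
    refine ⟨v, ?_, by simpa using h2, by simpa using h3, by simpa using h4, ?_⟩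
    · rwa [Finset.coe_univ, linearIndepOn_univ_iff] at h1
    · simpa [Set.injOn_univ] using h5
  intro t
  induction t using Finset.induction_on with
  | empty => exact ⟨0, by simp [linearIndepOn_empty]⟩
  | insert a t ha ih =>
    obtain ⟨v, h1, h2, h3, h4, h5⟩ := ih
    have hlt : Submodule.span ℝ (v '' (t : Set κ)) < ⊤ := by
      refine lt_top_iff_ne_top.2 fun htop => ?_
      have := finrank_span_finset_le_card (R := ℝ) (t.image v)
      rw [Finset.coe_image, Set.finrank, htop, finrank_top, Module.finrank_fintype_fun_eq_card] at this
      have h6 : t.card < Fintype.card κ := Finset.card_lt_univ_of_notMem ha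
      have h7 := t.card_image_le (f := v)
      omega
    obtain ⟨φ, hφ, hle⟩ := Submodule.exists_le_ker_of_lt_top _ hlt
    have hne (p : Module.Dual ℝ (κ → ℝ)) (hp : p ≠ 0) : ∃ x, p x ≠ 0 := by
      contrapose! hp
      exact LinearMap.ext hp
    obtain ⟨x, hx⟩ := Module.Dual.exists_forall_ne_zero_of_forall_exists
      (Sum.elim ![f, g, φ] (Sum.elim (fun z => h - e z • g)
        fun j : κ => h - (h (v j) / g (v j)) • g)) (by
        rintro (i | z | j)
        · fin_cases i
          exacts [hne _ hf, hne _ hg, hne _ hφ]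
        · exact hne _ (sub_ne_zero.2 (hgh _))
        · exact hne _ (sub_ne_zero.2 (hgh _)))
    have hxf : f x ≠ 0 := hx (.inl 0)
    have hxg : g x ≠ 0 := hx (.inl 1)
    have hxφ : φ x ≠ 0 := hx (.inl 2)
    have hxe (z) : h x / g x ≠ e z := fun heq => hx (.inr (.inl z)) (by
      simp [← heq]; field_simp; simp)
    have hxv (j) : h x / g x ≠ h (v j) / g (v j) := fun heq => hx (.inr (.inr j)) (by
      simp [← heq]; field_simp; simp)
    have hv (i) (hi : i ∈ t) : Function.update v a x i = v i :=
      Function.update_of_ne (ne_of_mem_of_not_mem hi ha) _ _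
    have hva : Function.update v a x a = x := Function.update_self ..
    have hEq : Set.EqOn (Function.update v a x) v (t : Set κ) := fun i hi => hv i hi
    refine ⟨Function.update v a x, ?_, ?_, ?_, ?_, ?_⟩
    · rw [Finset.coe_insert, linearIndepOn_insert (by simpa using ha), hva, hEq.image_eq]
      exact ⟨h1.congr hEq.symm, fun hmem => hxφ (hle hmem)⟩
    · simp only [Finset.forall_mem_insert, hva]
      exact ⟨hxf, fun i hi => by rw [hv i hi]; exact h2 i hi⟩
    · simp only [Finset.forall_mem_insert, hva]
      exact ⟨hxg, fun i hi => by rw [hv i hi]; exact h3 i hi⟩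
    · simp only [Finset.forall_mem_insert, hva]
      exact ⟨hxe, fun i hi => by rw [hv i hi]; exact h4 i hi⟩
    · rw [Finset.coe_insert, Set.injOn_insert (by simpa using ha)]
      refine ⟨fun i hi j hj hij => h5 hi hj ?_, ?_⟩
      · simpa only [hv i hi, hv j hj] using hij
      · rintro ⟨i, hi, hi'⟩
        simp only [hv i hi, hva] at hi'
        exact hxv i hi'.symm

theorem _root_.Matrix.diagonal_sumElim_one_zero {κ ζ : Type} [DecidableEq κ] [DecidableEq ζ] :
    (Matrix.diagonal (Sum.elim 1 0) : Matrix (κ ⊕ ζ) (κ ⊕ ζ) ℝ) = fromBlocks 1 0 0 0 := by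
  rw [← fromBlocks_diagonal]
  simp

section Blocks

variable {κ ζ : Type} [Fintype κ] [Fintype ζ] [DecidableEq κ] [DecidableEq ζ]

theorem of_fromBlocks_of_row {A₁ B₁ : Matrix κ κ ℝ} {A₂ B₂ : Matrix κ ζ ℝ}
    {A₃ B₃ : Matrix ζ κ ℝ} {z₀ : ζ} {k : κ} (hk : A₂ k z₀ ≠ 0) (hy : A₃ z₀ ≠ 0)
    (hy' : ∀ x : ℝ, B₃ z₀ ≠ x • A₃ z₀) :
    RankLE (2 * Fintype.card (κ ⊕ ζ) - 1) (fromBlocks A₁ A₂ A₃ 0) (fromBlocks B₁ B₂ B₃ 0)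
      (fromBlocks 1 0 0 0) := by
  obtain ⟨e, he, he₀⟩ := exists_injective_eq z₀ (B₂ k z₀ / A₂ k z₀)
  have hdual (y y' : κ → ℝ) (h : dotProductBilin ℝ ℝ y = dotProductBilin ℝ ℝ y') : y = y' := by
    ext i
    simpa using LinearMap.congr_fun h (Pi.single i 1)
  obtain ⟨v, hv, h1, h2, h3, h4⟩ := exists_linearIndependent_forall_ne
    (f := LinearMap.proj k) (g := dotProductBilin ℝ ℝ (A₃ z₀)) (h := dotProductBilin ℝ ℝ (B₃ z₀))
    (fun h => by simpa using LinearMap.congr_fun h (Pi.single k 1))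
    (fun h => hy (hdual _ _ (by rw [h, map_zero])))
    (fun x h => hy' x (hdual _ _ (by rw [h, map_smul]))) e
  let P : Matrix κ κ ℝ := of fun i j => v j i
  have hP : IsUnit P.det := (isUnit_iff_isUnit_det _).1 (linearIndependent_cols_iff_isUnit.1 hv)
  have hA₃ (j : κ) : (A₃ * P) z₀ j = A₃ z₀ ⬝ᵥ v j := rfl
  have hB₃ (j : κ) : (B₃ * P) z₀ j = B₃ z₀ ⬝ᵥ v j := rfl
  simp only [dotProductBilin_apply_apply, LinearMap.proj_apply] at h1 h2 h3 h4
  have hsv (X₁ : Matrix κ κ ℝ) (X₂ : Matrix κ ζ ℝ) (X₃ : Matrix ζ κ ℝ) :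
      ((Sum.elim (P k) 0 : κ ⊕ ζ → ℝ) ᵥ* fromBlocks (P⁻¹ * X₁ * P) (P⁻¹ * X₂) (X₃ * P) 0)
        (Sum.inr z₀) = X₂ k z₀ := by
    have : P k ᵥ* (P⁻¹ * X₂) = (P * (P⁻¹ * X₂)) k := rfl
    simp [vecMul_fromBlocks, this, mul_nonsing_inv_cancel_left _ _ hP]
  have key := of_diagonal_of_row (A := fromBlocks (P⁻¹ * A₁ * P) (P⁻¹ * A₂) (A₃ * P) 0)
    (B := fromBlocks (P⁻¹ * B₁ * P) (P⁻¹ * B₂) (B₃ * P) 0) (i₀ := Sum.inr z₀)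
    (c := Sum.elim 1 0) (s := Sum.elim (P k) 0)
    (d := Sum.elim (fun j => (A₃ z₀ ⬝ᵥ v j) / v j k) fun z => if z = z₀ then 0 else 1)
    (r := Sum.elim (fun j => (B₃ z₀ ⬝ᵥ v j) / (A₃ z₀ ⬝ᵥ v j)) e) (by simp) (by simp)
    (by
      rintro (j | z) hz
      · exact div_ne_zero (h2 j) (h1 j)
      · simpa using hz)
    (h4.sumElim he h3) (by simp)
    (by
      rintro (j | z)
      · have := h1 j
        simp [hA₃, P]
        field_simp
      · simp)
    (by
      rintro (j | z)
      · have := h1 j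
        have := h2 j
        simp [hB₃, P]
        field_simp
      · simp)
    (by rw [hsv]; exact hk) (by rw [hsv, hsv]; simp [he₀]; field_simp)
  have := key.mul_mul (fromBlocks P 0 0 (1 : Matrix ζ ζ ℝ))
    (fromBlocks P⁻¹ 0 0 (1 : Matrix ζ ζ ℝ))
  rw [← fromBlocks_diagonal] at this
  simpa [fromBlocks_multiply, Matrix.mul_assoc, mul_nonsing_inv_cancel_left _ _ hP,
    mul_nonsing_inv _ hP] using this

theorem of_fromBlocks {A B : Matrix (κ ⊕ ζ) (κ ⊕ ζ) ℝ} {z z' : ζ}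
    (h : A (Sum.inr z) (Sum.inr z') ≠ 0) :
    RankLE (2 * Fintype.card (κ ⊕ ζ) - 1) A B (fromBlocks 1 0 0 0) := by
  let σ : Equiv.Perm (κ ⊕ ζ) := Equiv.sumCongr (Equiv.refl κ) (Equiv.swap z z')
  have key := (of_diagonal (A := A.submatrix id σ) (B := B.submatrix id σ)
    (c := Sum.elim 1 0) (i₀ := Sum.inr z) (by simp) (by simpa [σ] using h)).submatrix id σ
  have hσ (i) : σ (σ i) = i := by rcases i with i | i <;> simp [σ]
  have hl (i : κ) : σ (Sum.inl i) = Sum.inl i := rfl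
  have hr (i : ζ) : σ (Sum.inr i) = Sum.inr (Equiv.swap z z' i) := rfl
  rw [diagonal_sumElim_one_zero] at key
  convert key using 1
  · ext i j; simp [hσ]
  · ext i j; simp [hσ]
  · ext i j; rcases i with i | i <;> rcases j with j | j <;> simp [hl, hr]

end Blocks

theorem of_diagonal_of_col_eq_zero {A B : Matrix n n ℝ} {c : n → ℝ} {i₀ : n} (hc : c i₀ = 0)
    (hA : ∀ i, A i i₀ = 0) (hB : ∀ i, B i i₀ = 0) :
    RankLE (2 * Fintype.card n - 1) A B (Matrix.diagonal c) := by
  have key := (of_diagonal (A := A.updateCol i₀ (Pi.single i₀ 1)) (B := B) hc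
    (by simp)).mul_mul (1 : Matrix n n ℝ) (Matrix.diagonal fun i => if i = i₀ then 0 else 1)
  convert key using 1 <;>
  · ext i j
    rcases eq_or_ne j i₀ with rfl | hj
    · rcases eq_or_ne i j with rfl | hij <;> simp [*]
    · simp [hj]

/-- Removing a row and a column, both of rank one. -/
theorem of_diagonal_of_row_col {A B : Matrix n n ℝ} {c u z : n → ℝ} {i₀ k : n} {ρ β β' : ℝ}
    (hc : c i₀ = 0) (ih : ∀ A B C : Matrix {i // i ≠ i₀} {i // i ≠ i₀} ℝ, C.det = 0 →
      RankLE (2 * (Fintype.card n - 1) - 1) A B C)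
    (hA : ∀ i, A i i₀ = u i) (hB : ∀ i, B i i₀ = ρ * u i) (hA' : ∀ j, A i₀ j = β * z j)
    (hB' : ∀ j, B i₀ j = β' * z j) (hu : u i₀ = 0) (hz : z i₀ = 0) (hk : u k ≠ 0) :
    RankLE (2 * Fintype.card n - 1) A B (Matrix.diagonal c) := by
  have hki : k ≠ i₀ := by rintro rfl; exact hk hu
  have hcard : 1 < Fintype.card n := Fintype.one_lt_card_iff.2 ⟨k, i₀, hki⟩
  let w : n → ℝ := fun j => A k j / u k
  let X (M : Matrix n n ℝ) (a b : ℝ) : Matrix n n ℝ :=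
    M - a • Matrix.vecMulVec u w - b • Matrix.vecMulVec (Pi.single i₀ 1) z
  have hw : w i₀ = 1 := by simp [w, hA, hk]
  have h1 : RankLE (2 * (Fintype.card n - 1) - 1) (X A 1 β) (X B ρ β')
      (X (Matrix.diagonal c) 0 0) := by
    refine of_submatrix_ne i₀ (ih _ _ _ ?_).rotate.rotate ?_ ?_ ?_ ?_ ?_ ?_
    · refine det_eq_zero_of_row_eq_zero ⟨k, hki⟩ fun j => ?_
      simp [X, w, vecMulVec_apply, hki]
      field_simp
      simp
    all_goals intro i
    · simp [X, vecMulVec_apply, hA, hw, hz]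
    · simp [X, vecMulVec_apply, hA', hu]
    · simp [X, vecMulVec_apply, hB, hw, hz]
    · simp [X, vecMulVec_apply, hB', hu]
    · rcases eq_or_ne i i₀ with rfl | hi <;> simp [X, *]
    · rcases eq_or_ne i₀ i with rfl | hi <;> simp [X, *]
  have h2 := (h1.add (RankLE.vecMulVec u w 1 ρ 0)).add
    (RankLE.vecMulVec (Pi.single i₀ 1) z β β' 0)
  simp only [X, sub_add_cancel, zero_smul, sub_zero, add_zero, sub_add_eq_add_sub] at h2
  exact h2.mono (by omega)

section Blocks

variable {κ ζ : Type} [Fintype κ] [Fintype ζ] [DecidableEq κ] [DecidableEq ζ]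

theorem of_fromBlocks_of_col {A₁ B₁ : Matrix κ κ ℝ} {A₂ B₂ : Matrix κ ζ ℝ}
    {A₃ B₃ : Matrix ζ κ ℝ} {z₀ : ζ} {k : κ} (hk : A₂ k z₀ ≠ 0)
    (ih : ∀ (i₀ : κ ⊕ ζ) (A B C : Matrix {i // i ≠ i₀} {i // i ≠ i₀} ℝ), C.det = 0 →
      RankLE (2 * (Fintype.card (κ ⊕ ζ) - 1) - 1) A B C) :
    RankLE (2 * Fintype.card (κ ⊕ ζ) - 1) (fromBlocks A₁ A₂ A₃ 0) (fromBlocks B₁ B₂ B₃ 0)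
      (fromBlocks 1 0 0 0) := by
  by_cases hrow : A₃ z₀ ≠ 0 ∧ ∀ x : ℝ, B₃ z₀ ≠ x • A₃ z₀
  · exact of_fromBlocks_of_row hk hrow.1 hrow.2
  have hA₂ : A₂ᵀ z₀ ≠ 0 := fun h => hk (congrFun h k)
  by_cases hcol : ∀ x : ℝ, B₂ᵀ z₀ ≠ x • A₂ᵀ z₀
  · suffices h : RankLE (2 * Fintype.card (κ ⊕ ζ) - 1) (fromBlocks A₁ᵀ A₃ᵀ A₂ᵀ 0)
        (fromBlocks B₁ᵀ B₃ᵀ B₂ᵀ 0) (fromBlocks 1 0 0 0) by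
      simpa [fromBlocks_transpose] using h.transpose
    by_cases hA : A₃ z₀ = 0
    · by_cases hB : B₃ z₀ = 0
      · rw [← diagonal_sumElim_one_zero]
        refine of_diagonal_of_col_eq_zero (i₀ := Sum.inr z₀) (by simp) ?_ ?_ <;>
        · rintro (i | i) <;> simp [hA, hB]
      · obtain ⟨k', hk'⟩ := Function.ne_iff.1 hB
        refine (of_fromBlocks_of_row (k := k') (z₀ := z₀) hk' (fun h => hcol 0 (by simp [h]))
          fun x hx => ?_).swap
        have hx₀ : x ≠ 0 := by rintro rfl; exact hA₂ (by simpa using hx)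
        exact hcol x⁻¹ (by rw [hx, inv_smul_smul₀ hx₀])
    · obtain ⟨k', hk'⟩ := Function.ne_iff.1 hA
      exact of_fromBlocks_of_row (k := k') (z₀ := z₀) hk' hA₂ hcol
  obtain ⟨ρ, hρ⟩ : ∃ ρ : ℝ, B₂ᵀ z₀ = ρ • A₂ᵀ z₀ := by simpa using hcol
  obtain ⟨z, β, β', hz, hz'⟩ : ∃ (z : κ → ℝ) (β β' : ℝ), A₃ z₀ = β • z ∧ B₃ z₀ = β' • z := by
    by_cases hA : A₃ z₀ = 0
    · exact ⟨B₃ z₀, 0, 1, by simp [hA], by simp⟩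
    · obtain ⟨x, hx⟩ : ∃ x : ℝ, B₃ z₀ = x • A₃ z₀ := by simpa [hA] using hrow
      exact ⟨A₃ z₀, 1, x, by simp, hx⟩
  rw [← diagonal_sumElim_one_zero]
  refine of_diagonal_of_row_col (i₀ := Sum.inr z₀) (k := Sum.inl k) (u := Sum.elim (A₂ᵀ z₀) 0)
    (z := Sum.elim z 0) (ρ := ρ) (β := β) (β' := β') (by simp) (ih _) ?_ ?_ ?_ ?_ (by simp)
    (by simp) (by simpa using hk)
  all_goals rintro (i | i)
  any_goals simp
  · exact congrFun hρ i
  · exact congrFun hz i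
  · exact congrFun hz' i

theorem of_fromBlocks_one_zero [Nonempty ζ] {A B : Matrix (κ ⊕ ζ) (κ ⊕ ζ) ℝ}
    (ih : ∀ (i₀ : κ ⊕ ζ) (A B C : Matrix {i // i ≠ i₀} {i // i ≠ i₀} ℝ), C.det = 0 →
      RankLE (2 * (Fintype.card (κ ⊕ ζ) - 1) - 1) A B C) :
    RankLE (2 * Fintype.card (κ ⊕ ζ) - 1) A B (fromBlocks 1 0 0 0) := by
  by_cases hA : ∃ z z', A (Sum.inr z) (Sum.inr z') ≠ 0
  · obtain ⟨z, z', h⟩ := hA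
    exact of_fromBlocks h
  by_cases hB : ∃ z z', B (Sum.inr z) (Sum.inr z') ≠ 0
  · obtain ⟨z, z', h⟩ := hB
    exact (of_fromBlocks h).swap
  push Not at hA hB
  obtain ⟨z₀⟩ := ‹Nonempty ζ›
  have eA : A = fromBlocks A.toBlocks₁₁ A.toBlocks₁₂ A.toBlocks₂₁ 0 := by
    rw [← show A.toBlocks₂₂ = 0 from ext hA, fromBlocks_toBlocks]
  have eB : B = fromBlocks B.toBlocks₁₁ B.toBlocks₁₂ B.toBlocks₂₁ 0 := by
    rw [← show B.toBlocks₂₂ = 0 from ext hB, fromBlocks_toBlocks]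
  by_cases hA₂ : ∃ k, A.toBlocks₁₂ k z₀ ≠ 0
  · obtain ⟨k, hk⟩ := hA₂
    rw [eA, eB]
    exact of_fromBlocks_of_col hk ih
  by_cases hB₂ : ∃ k, B.toBlocks₁₂ k z₀ ≠ 0
  · obtain ⟨k, hk⟩ := hB₂
    rw [eA, eB]
    exact (of_fromBlocks_of_col hk ih).swap
  push Not at hA₂ hB₂
  rw [← diagonal_sumElim_one_zero]
  refine of_diagonal_of_col_eq_zero (i₀ := Sum.inr z₀) (by simp) ?_ ?_
  · rintro (i | i)
    exacts [hA₂ i, hA i z₀]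
  · rintro (i | i)
    exacts [hB₂ i, hB i z₀]

end Blocks

/-- A square tensor with a singular slice has rank at most `2 * n - 1`. -/
theorem of_det_eq_zero_slice (k : ℕ) : ∀ (n : Type) [Fintype n] [DecidableEq n],
    Fintype.card n = k → ∀ A B C : Matrix n n ℝ, C.det = 0 → RankLE (2 * k - 1) A B C := by
  induction k using Nat.strong_induction_on with
  | _ k ih =>
    intro n _ _ hn A B C hC
    obtain ⟨L, L', D, hD⟩ := Pivot.exists_list_transvec_mul_mul_list_transvec_eq_diagonal C
    set U := (L.map TransvectionStruct.toMatrix).prod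
    set V := (L'.map TransvectionStruct.toMatrix).prod
    have hU₁ : U.det = 1 := TransvectionStruct.det_toMatrix_prod L
    have hV₁ : V.det = 1 := TransvectionStruct.det_toMatrix_prod L'
    obtain ⟨i₀, hi₀⟩ : ∃ i, D i = 0 := by
      have := congrArg det hD
      rw [det_mul, det_mul, hC, det_diagonal, mul_zero, zero_mul] at this
      simpa using Finset.prod_eq_zero_iff.1 this.symm
    let e := Equiv.sumCompl fun i => D i ≠ 0
    have : Nonempty {i // ¬ D i ≠ 0} := ⟨⟨i₀, by simpa using hi₀⟩⟩
    let g : n → ℝ := fun i => if D i = 0 then 1 else D i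
    have hg (i) : g i ≠ 0 := by by_cases h : D i = 0 <;> simp [g, h]
    have hcard : Fintype.card ({i // D i ≠ 0} ⊕ {i // ¬ D i ≠ 0}) = k := by
      rw [Fintype.card_congr e, hn]
    have hk : 0 < k := hn ▸ Fintype.card_pos_iff.2 ⟨i₀⟩
    have hE : (fromBlocks 1 0 0 0 : Matrix ({i // D i ≠ 0} ⊕ {i // ¬ D i ≠ 0}) _ ℝ) =
        (Matrix.diagonal fun i => if D i = 0 then 0 else 1).submatrix e e := by
      rw [submatrix_diagonal_equiv, ← diagonal_sumElim_one_zero]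
      congr 1
      ext (i | i)
      · have := i.2
        simp [e, this]
      · have := not_not.1 i.2
        simp [e, this]
    have hU : IsUnit U.det := by simp [hU₁]
    have hV : IsUnit V.det := by simp [hV₁]
    have hgg : Matrix.diagonal g * Matrix.diagonal (fun i => (g i)⁻¹) = 1 := by
      rw [diagonal_mul_diagonal, ← diagonal_one]
      exact congrArg _ (funext fun i => mul_inv_cancel₀ (hg i))
    have hX (X : Matrix n n ℝ) :
        U⁻¹ * Matrix.diagonal g * (Matrix.diagonal (fun i => (g i)⁻¹) * (U * X * V)) * V⁻¹ =
          X := by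
      rw [Matrix.mul_assoc U⁻¹, ← Matrix.mul_assoc (Matrix.diagonal g), hgg, Matrix.one_mul,
        Matrix.mul_assoc U, nonsing_inv_mul_cancel_left _ _ hU,
        mul_nonsing_inv_cancel_right _ _ hV]
    have hC' : U⁻¹ * Matrix.diagonal g * Matrix.diagonal (fun i => if D i = 0 then 0 else 1) *
        V⁻¹ = C := by
      have hgD : Matrix.diagonal g * Matrix.diagonal (fun i => if D i = 0 then 0 else 1) =
          Matrix.diagonal D := by
        rw [diagonal_mul_diagonal]
        refine congrArg _ (funext fun i => ?_)
        by_cases h : D i = 0 <;> simp [g, h]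
      rw [Matrix.mul_assoc U⁻¹, hgD, ← hD, Matrix.mul_assoc U, nonsing_inv_mul_cancel_left _ _ hU,
        mul_nonsing_inv_cancel_right _ _ hV]
    have key := of_fromBlocks_one_zero
      (A := (Matrix.diagonal (fun i => (g i)⁻¹) * (U * A * V)).submatrix e e)
      (B := (Matrix.diagonal (fun i => (g i)⁻¹) * (U * B * V)).submatrix e e)
      fun i₀ A B C hC => by
        refine ih _ (by omega) _ ?_ A B C hC
        simp [Fintype.card_subtype_compl, -Fintype.card_sum]
    have key := (key.submatrix e.symm e.symm).mul_mul (U⁻¹ * Matrix.diagonal g) V⁻¹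
    rwa [hE, hcard, submatrix_submatrix, submatrix_submatrix, submatrix_submatrix,
      e.self_comp_symm, submatrix_id_id, submatrix_id_id, submatrix_id_id, hX, hX, hC'] at key

theorem of_odd_card (h : Odd (Fintype.card n)) (A B C : Matrix n n ℝ) :
    RankLE (2 * Fintype.card n - 1) A B C := by
  suffices H : A.det = 0 ∨ ∃ x : ℝ, (C + x • A).det = 0 by
    rcases H with hA | ⟨x, hx⟩
    · exact (of_det_eq_zero_slice _ n rfl B C A hA).rotate.rotate
    · simpa using (of_det_eq_zero_slice _ n rfl A B _ hx).add_smul (-x)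
  let f : ℝ → ℝ := fun θ => (Real.cos θ • A + Real.sin θ • C).det
  have hf : Continuous f := by fun_prop
  obtain ⟨θ, -, hθ⟩ : (0 : ℝ) ∈ f '' Set.uIcc 0 Real.pi := by
    refine intermediate_value_uIcc hf.continuousOn ?_
    have h0 : f 0 = A.det := by simp [f]
    have h1 : f Real.pi = -A.det := by simp [f, det_neg, h.neg_one_pow]
    rw [h0, h1, Set.mem_uIcc]
    rcases le_total A.det 0 with h | h
    · exact Or.inl ⟨h, by linarith⟩
    · exact Or.inr ⟨by linarith, h⟩
  by_cases hs : Real.sin θ = 0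
  · left
    have hc : Real.cos θ ≠ 0 := fun hc => by
      have := Real.sin_sq_add_cos_sq θ
      simp [hs, hc] at this
    simpa [f, hs, det_smul, hc] using hθ
  · right
    refine ⟨Real.cos θ / Real.sin θ, ?_⟩
    have : Real.cos θ • A + Real.sin θ • C =
        Real.sin θ • (C + (Real.cos θ / Real.sin θ) • A) := by
      rw [smul_add, smul_smul, mul_div_cancel₀ _ hs, add_comm]
    have hθ' : (Real.sin θ • (C + (Real.cos θ / Real.sin θ) • A)).det = 0 := this ▸ hθ
    rw [det_smul] at hθ'
    exact (mul_eq_zero.1 hθ').resolve_left (pow_ne_zero _ hs)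

end RankLE

/-- If `n` is an odd positive integer, then every `n × n × 3` tensor over `ℝ` has
rank at most `2 * n - 1`. -/
theorem stmt19 {n : ℕ} (hn : 0 < n) (hodd : Odd n) :
    maxRank ℝ n n 3 ≤ 2 * n - 1 := by
  refine csSup_le (Set.range_nonempty (tensorRank ℝ)) ?_
  rintro _ ⟨A, rfl⟩
  obtain ⟨k, u, v, α, β, γ, hk, h0, h1, h2⟩ :=
    (RankLE.of_odd_card (by simpa using hodd) (A 0) (A 1) (A 2)).exists_sum
  rw [Fintype.card_fin] at hk
  refine le_trans ?_ hk
  unfold tensorRank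
  refine Nat.sInf_le ⟨u, v, fun i => ![α i, β i, γ i], fun j => ?_⟩
  fin_cases j
  exacts [h0, h1, h2]
end
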